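/- arXiv:2110.13906 — 2 statements merged into one kernel-verified Lean document; each statement's English description precedes it below -/
import Mathlib

section
/- For every n ≥ 1, the bi-statistics (inv, coinv) on rooted forests R_n and (area, coarea) on minimal factorizations F_n have the same joint distribution; that is, there exists a bijection ψ: F_n → R_n such that inv(ψ(f)) = area(f) and coinv(ψ(f)) = coarea(f) for all f ∈ F_n. -/
/-- A rooted forest on vertex set `V`, encoded by its parent function:
`parent v = some u` means `u` is the parent of `v` (edges are directed away from
the roots, so `(u,v)` is an edge), and `parent v = none` means `v` is a root.
Acyclicity guarantees that every connected component is a tree with a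
distinguished root. -/
structure RootedForest (V : Type) where
  parent : V → Option V
  acyclic : ∀ v : V, ¬ Relation.TransGen (fun a b : V => parent a = some b) v v

namespace RootedForest

variable {V : Type} [Fintype V] [LinearOrder V]

/-- `F.Desc u v` means `v` is a (strict) descendant of `u`. -/
def Desc (F : RootedForest V) (u v : V) : Prop :=
  Relation.TransGen (fun a b : V => F.parent a = some b) v u

/-- The hook of `u`: `u` together with all of its descendants. -/
def hook (F : RootedForest V) (u : V) : Set V := {v : V | v = u ∨ F.Desc u v}

/-- The hook length `h(u)`. -/
noncomputable def h (F : RootedForest V) (u : V) : ℕ := (F.hook u).ncard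

/-- The left hook length `h_L(u)`: sum of hook lengths of children smaller than `u`. -/
noncomputable def hL (F : RootedForest V) (u : V) : ℕ :=
  ∑ v ∈ Finset.univ.filter (fun v : V => F.parent v = some u ∧ v < u), F.h v

/-- The right hook length `h_R(u)`: sum of hook lengths of children larger than `u`. -/
noncomputable def hR (F : RootedForest V) (u : V) : ℕ :=
  ∑ v ∈ Finset.univ.filter (fun v : V => F.parent v = some u ∧ u < v), F.h v

/-- The major index of a rooted forest. -/
noncomputable def maj (F : RootedForest V) : ℕ := ∑ u : V, F.hL u

/-- The comajor index of a rooted forest. -/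
noncomputable def comaj (F : RootedForest V) : ℕ := ∑ u : V, F.hR u

/-- The number of inversions: pairs `(u,v)` with `v` a descendant of `u` and `v < u`. -/
noncomputable def inv (F : RootedForest V) : ℕ :=
  {p : V × V | F.Desc p.1 p.2 ∧ p.2 < p.1}.ncard

/-- The number of coinversions: pairs `(u,v)` with `v` a descendant of `u` and `v > u`. -/
noncomputable def coinv (F : RootedForest V) : ℕ :=
  {p : V × V | F.Desc p.1 p.2 ∧ p.1 < p.2}.ncard

/-- The number of connected components (= number of roots). -/
def comps (F : RootedForest V) : ℕ :=
  (Finset.univ.filter (fun v : V => F.parent v = none)).card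

end RootedForest

/-- A `k`-forest on vertex set `Fin n` (vertices `1,…,n`): a rooted forest together with a
colour in `{0,…,k-1}` on each edge.  The colour of the edge `(parent v, v)` is recorded
at the vertex `v`; roots carry the dummy colour `0`. -/
structure KForest (n k : ℕ) extends RootedForest (Fin n) where
  colour : Fin n → ℕ
  colour_lt : ∀ v, colour v < k
  colour_root : ∀ v, parent v = none → colour v = 0

namespace KForest

variable {n k : ℕ}

/-- The chromatic depth `chr_k(F) = ∑_{(u,v) ∈ E(F)} κ(u,v)·h(v)`. -/
noncomputable def chr (F : KForest n k) : ℕ :=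
  ∑ v ∈ Finset.univ.filter (fun v : Fin n => F.parent v ≠ none),
    F.colour v * F.toRootedForest.h v

/-- The chromatic codepth `cochr_k(F) = ∑_{(u,v) ∈ E(F)} (k-1-κ(u,v))·h(v)`. -/
noncomputable def cochr (F : KForest n k) : ℕ :=
  ∑ v ∈ Finset.univ.filter (fun v : Fin n => F.parent v ≠ none),
    (k - 1 - F.colour v) * F.toRootedForest.h v

/-- `maj_k = maj + chr_k`. -/
noncomputable def majk (F : KForest n k) : ℕ := F.toRootedForest.maj + F.chr

/-- `comaj_k = comaj + cochr_k`. -/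
noncomputable def comajk (F : KForest n k) : ℕ := F.toRootedForest.comaj + F.cochr

/-- `inv_k = inv + chr_k`. -/
noncomputable def invk (F : KForest n k) : ℕ := F.toRootedForest.inv + F.chr

/-- `coinv_k = coinv + cochr_k`. -/
noncomputable def coinvk (F : KForest n k) : ℕ := F.toRootedForest.coinv + F.cochr

end KForest

/-- A minimal factorization of the long cycle `(0 1 ⋯ n)` on `{0,1,…,n}` into `n`
transpositions `(aᵢ bᵢ)` with `aᵢ < bᵢ`, multiplied left to right (the leftmost factor
is applied first, which corresponds to the reversed product in Mathlib's convention). -/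
structure MinFact (n : ℕ) where
  a : Fin n → Fin (n+1)
  b : Fin n → Fin (n+1)
  ab_lt : ∀ i, a i < b i
  prod_eq : (List.ofFn (fun i => Equiv.swap (a i) (b i))).reverse.prod = finRotate (n+1)

namespace MinFact

variable {n : ℕ}

/-- `area(f) = C(n,2) - ∑ aᵢ`. -/
def area (f : MinFact n) : ℤ := (n.choose 2 : ℤ) - ∑ i : Fin n, ((f.a i : ℕ) : ℤ)

/-- `coarea(f) = ∑ (bᵢ - 1) - C(n,2)`. -/
def coarea (f : MinFact n) : ℤ :=
  (∑ i : Fin n, (((f.b i : ℕ) : ℤ) - 1)) - (n.choose 2 : ℤ)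

end MinFact

/-- A minimal `k`-factorization of the long cycle `(0 1 ⋯ kn)` on `{0,1,…,kn}` into `n`
cycles of length `k+1`: the `j`-th factor is the cycle `(a j 0, a j 1, …, a j k)`
(sending `a j 0 ↦ a j 1 ↦ ⋯ ↦ a j k ↦ a j 0`), presented with its least element first,
and the factors are multiplied left to right (leftmost applied first). -/
structure MinKFact (n k : ℕ) where
  a : Fin n → Fin (k+1) → Fin (k*n+1)
  inj : ∀ j, Function.Injective (a j)
  min_first : ∀ j i, a j 0 ≤ a j i
  prod_eq :
    (List.ofFn (fun j => (List.ofFn (a j)).formPerm)).reverse.prod = finRotate (k*n+1)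

namespace MinKFact

variable {n k : ℕ}

/-- `area_k(f) = C(kn,2) - n·C(k,2) - k·∑_j a_j^0`. -/
def areak (f : MinKFact n k) : ℤ :=
  ((k*n).choose 2 : ℤ) - n * (k.choose 2 : ℤ) - k * ∑ j : Fin n, ((f.a j 0 : ℕ) : ℤ)

/-- `coarea_k(f) = k·∑_j (a_j^k - 1) - C(kn,2) - n·C(k,2)`. -/
def coareak (f : MinKFact n k) : ℤ :=
  k * (∑ j : Fin n, (((f.a j (Fin.last k) : ℕ) : ℤ) - 1))
    - ((k*n).choose 2 : ℤ) - n * (k.choose 2 : ℤ)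

/-- `semiarea_k(f) = C(kn,2) - ∑_{i=0}^{k-1} ∑_j a_j^i`. -/
def semiareak (f : MinKFact n k) : ℤ :=
  ((k*n).choose 2 : ℤ) - ∑ i : Fin k, ∑ j : Fin n, ((f.a j i.castSucc : ℕ) : ℤ)

/-- `cosemiarea_k(f) = ∑_{i=1}^{k} ∑_j (a_j^i - 1) - C(kn,2)`. -/
def cosemiareak (f : MinKFact n k) : ℤ :=
  (∑ i : Fin k, ∑ j : Fin n, (((f.a j i.succ : ℕ) : ℤ) - 1)) - ((k*n).choose 2 : ℤ)

end MinKFact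

/-- `p` is a `k`-parking function: its nondecreasing rearrangement `b = p ∘ sort p`
satisfies `b i ≤ k * i` (with 0-indexed `i`, matching `bᵢ ≤ k(i-1)` for 1-indexed `i`). -/
def IsParkingFunction (k : ℕ) {n : ℕ} (p : Fin n → ℕ) : Prop :=
  ∀ i : Fin n, p (Tuple.sort p i) ≤ k * i

/-- The displacement `disp_k(p) = k·C(n,2) - ∑ᵢ aᵢ` of a `k`-parking function. -/
def dispk (k : ℕ) {n : ℕ} (p : Fin n → ℕ) : ℤ :=
  k * (n.choose 2 : ℤ) - ∑ i : Fin n, (p i : ℤ)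
namespace RootedForest

variable {n : ℕ}

open Classical in
/-- strict descendants as a finset -/
noncomputable def dsc (F : RootedForest (Fin n)) (v : Fin n) : Finset (Fin n) :=
  Finset.univ.filter (fun u => F.Desc v u)

/-- vertices with given parent -/
def kids (F : RootedForest (Fin n)) (o : Option (Fin n)) : Finset (Fin n) :=
  Finset.univ.filter (fun w => F.parent w = o)

lemma mem_kids (F : RootedForest (Fin n)) (o : Option (Fin n)) (w : Fin n) :
    w ∈ F.kids o ↔ F.parent w = o := by simp [kids]

lemma mem_dsc (F : RootedForest (Fin n)) (u v : Fin n) :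
    u ∈ F.dsc v ↔ F.Desc v u := by simp [dsc]

lemma mem_dsc_head (F : RootedForest (Fin n)) (u v : Fin n) :
    u ∈ F.dsc v ↔ ∃ p, F.parent u = some p ∧ (p = v ∨ p ∈ F.dsc v) := by
  simp only [mem_dsc, Desc]
  constructor
  · intro h
    rcases Relation.TransGen.head'_iff.1 h with ⟨p, hp, hr⟩
    refine ⟨p, hp, ?_⟩
    rcases Relation.reflTransGen_iff_eq_or_transGen.1 hr with h | h
    · exact Or.inl h.symm
    · exact Or.inr h
  · rintro ⟨p, hp, rfl | h⟩
    · exact Relation.TransGen.single hp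
    · exact Relation.TransGen.head hp h

lemma mem_dsc_tail (F : RootedForest (Fin n)) (u v : Fin n) :
    u ∈ F.dsc v ↔ ∃ c, F.parent c = some v ∧ (u = c ∨ u ∈ F.dsc c) := by
  simp only [mem_dsc, Desc]
  constructor
  · intro h
    rcases Relation.TransGen.tail'_iff.1 h with ⟨p, hr, hp⟩
    refine ⟨p, hp, ?_⟩
    rcases Relation.reflTransGen_iff_eq_or_transGen.1 hr with h | h
    · exact Or.inl h.symm
    · exact Or.inr h
  · rintro ⟨p, hp, rfl | h⟩
    · exact Relation.TransGen.single hp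
    · exact Relation.TransGen.tail h hp

lemma not_mem_dsc_self (F : RootedForest (Fin n)) (v : Fin n) : v ∉ F.dsc v := by
  rw [mem_dsc]; exact F.acyclic v

lemma dsc_trans (F : RootedForest (Fin n)) {u v w : Fin n} (h1 : u ∈ F.dsc v)
    (h2 : v ∈ F.dsc w) : u ∈ F.dsc w := by
  rw [mem_dsc] at *
  exact Relation.TransGen.trans h1 h2

lemma dsc_subset (F : RootedForest (Fin n)) {v w : Fin n} (h2 : v ∈ F.dsc w) :
    F.dsc v ⊆ F.dsc w := fun _ h => F.dsc_trans h h2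

lemma dsc_asymm (F : RootedForest (Fin n)) {u v : Fin n} (h1 : u ∈ F.dsc v) :
    v ∉ F.dsc u := fun h2 => F.not_mem_dsc_self _ (F.dsc_trans h1 h2)

/-- two ancestors of the same vertex are comparable -/
lemma dsc_comparable (F : RootedForest (Fin n)) {x u v : Fin n} (h1 : x ∈ F.dsc u)
    (h2 : x ∈ F.dsc v) : u = v ∨ u ∈ F.dsc v ∨ v ∈ F.dsc u := by
  rw [mem_dsc] at h1 h2
  have hU : Relator.RightUnique (fun a b : Fin n => F.parent a = some b) := by
    intro a b c hb hc
    have : some b = some c := hb.symm.trans hc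
    exact Option.some.inj this
  have := Relation.ReflTransGen.total_of_right_unique hU h1.to_reflTransGen h2.to_reflTransGen
  simp only [mem_dsc, Desc]
  rcases this with h | h
  · rcases Relation.reflTransGen_iff_eq_or_transGen.1 h with h | h
    · exact Or.inl h.symm
    · exact Or.inr (Or.inl h)
  · rcases Relation.reflTransGen_iff_eq_or_transGen.1 h with h | h
    · exact Or.inl h
    · exact Or.inr (Or.inr h)

lemma h_eq_card (F : RootedForest (Fin n)) (v : Fin n) : F.h v = (F.dsc v).card + 1 := by
  have : F.hook v = ((insert v (F.dsc v) : Finset (Fin n)) : Set (Fin n)) := by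
    ext u
    simp [hook, mem_dsc]
  rw [h, this, Set.ncard_coe_finset, Finset.card_insert_of_notMem (F.not_mem_dsc_self v)]

lemma h_pos (F : RootedForest (Fin n)) (v : Fin n) : 0 < F.h v := by
  rw [h_eq_card]; omega

lemma kid_mem_dsc (F : RootedForest (Fin n)) {c v : Fin n} (h : F.parent c = some v) :
    c ∈ F.dsc v := (F.mem_dsc_head c v).2 ⟨v, h, Or.inl rfl⟩

lemma kid_ne (F : RootedForest (Fin n)) {c v : Fin n} (h : F.parent c = some v) :
    c ≠ v := by
  rintro rfl
  exact F.not_mem_dsc_self _ (F.kid_mem_dsc h)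

lemma kids_not_dsc (F : RootedForest (Fin n)) {c d v : Fin n} (hc : F.parent c = some v)
    (hd : F.parent d = some v) : c ∉ F.dsc d := by
  intro h
  obtain ⟨p, hp, h⟩ := (F.mem_dsc_head c d).1 h
  rw [hc] at hp
  cases hp
  rcases h with rfl | h
  · exact F.kid_ne hd rfl
  · exact F.dsc_asymm h (F.kid_mem_dsc hd)

lemma h_rec (F : RootedForest (Fin n)) (v : Fin n) :
    F.h v = 1 + ∑ w ∈ F.kids (some v), F.h w := by
  have h1 : F.dsc v = (F.kids (some v)).biUnion (fun c => insert c (F.dsc c)) := by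
    ext u
    rw [mem_dsc_tail]
    simp [mem_kids]
  rw [h_eq_card, h1, Finset.card_biUnion, add_comm]
  · congr 1
    apply Finset.sum_congr rfl
    intro w _
    rw [h_eq_card, Finset.card_insert_of_notMem (F.not_mem_dsc_self w)]
  · intro c hc d hd hcd
    rw [Finset.mem_coe, mem_kids] at hc hd
    rw [Function.onFun, Finset.disjoint_left]
    intro x hx hy
    rw [Finset.mem_insert] at hx hy
    rcases hx with rfl | hx
    · rcases hy with rfl | hy
      · exact hcd rfl
      · exact F.kids_not_dsc hc hd hy
    · rcases hy with rfl | hy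
      · exact F.kids_not_dsc hd hc hx
      · rcases F.dsc_comparable hx hy with h | h | h
        · exact hcd h
        · exact F.kids_not_dsc hc hd h
        · exact F.kids_not_dsc hd hc h

/-- the parent relation is well founded (from the roots down) -/
lemma wf_parent (F : RootedForest (Fin n)) :
    WellFounded (fun p c : Fin n => F.parent c = some p) := by
  apply Subrelation.wf (r := fun p c : Fin n => F.h c + 0 < F.h p + 0 )
  · intro p c hc
    have h1 := Finset.card_lt_card (s := F.dsc c) (t := F.dsc p) (by
      rw [Finset.ssubset_iff_of_subset (F.dsc_subset (F.kid_mem_dsc hc))]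
      exact ⟨c, F.kid_mem_dsc hc, F.not_mem_dsc_self c⟩)
    rw [h_eq_card, h_eq_card]
    omega
  · have : IsTrans (Fin n) (fun p c : Fin n => F.h c + 0 < F.h p + 0) := ⟨by intros; omega⟩
    have : Std.Irrefl (fun p c : Fin n => F.h c + 0 < F.h p + 0) := ⟨by intros; omega⟩
    exact Finite.wellFounded_of_trans_of_irrefl _

lemma sum_kids (F : RootedForest (Fin n)) (g : Fin n → ℤ) :
    ∑ w, g w = ∑ w ∈ F.kids none, g w + ∑ v, ∑ w ∈ F.kids (some v), g w := by
  have : ∑ w, g w = ∑ o : Option (Fin n), ∑ w ∈ F.kids o, g w := by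
    simp only [kids]
    rw [Finset.sum_fiberwise]
  rw [this, Fintype.sum_option]

lemma sum_roots (F : RootedForest (Fin n)) : ∑ w ∈ F.kids none, (F.h w : ℤ) = n := by
  have h1 := F.sum_kids (fun w => (F.h w : ℤ))
  have h2 : ∑ w, (F.h w : ℤ) = n + ∑ v, ∑ w ∈ F.kids (some v), (F.h w : ℤ) := by
    rw [Finset.sum_congr rfl (fun v _ => by
      rw [F.h_rec v]; push_cast; rfl : ∀ v ∈ Finset.univ, (F.h v : ℤ) =
        1 + ∑ w ∈ F.kids (some v), (F.h w : ℤ))]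
    rw [Finset.sum_add_distrib]
    simp
  linarith

lemma hL_eq (F : RootedForest (Fin n)) (v : Fin n) :
    F.hL v = ∑ w ∈ (F.kids (some v)).filter (fun w => w < v), F.h w := by
  simp only [hL, kids, Finset.filter_filter]

lemma hR_eq (F : RootedForest (Fin n)) (v : Fin n) :
    F.hR v = ∑ w ∈ (F.kids (some v)).filter (fun w => v < w), F.h w := by
  simp only [hR, kids, Finset.filter_filter]

lemma h_eq_LR (F : RootedForest (Fin n)) (v : Fin n) : F.h v = 1 + F.hL v + F.hR v := by
  rw [hL_eq, hR_eq, h_rec, add_assoc, add_left_cancel_iff,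
    ← Finset.sum_filter_add_sum_filter_not (F.kids (some v)) (fun w => w < v)]
  congr 2
  apply Finset.filter_congr
  intro w hw
  have := F.kid_ne ((F.mem_kids _ _).1 hw)
  omega

end RootedForest
/-- partial sums over the indices below `t` -/
def psum {n : ℕ} (g : Fin n → ℤ) (t : ℕ) : ℤ := ∑ s : Fin n, if s.val < t then g s else 0

lemma psum_zero {n : ℕ} (g : Fin n → ℤ) : psum g 0 = 0 := by simp [psum]

lemma psum_all {n : ℕ} (g : Fin n → ℤ) : psum g n = ∑ s, g s := by simp [psum]

lemma psum_succ {n : ℕ} (g : Fin n → ℤ) (t : Fin n) :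
    psum g (t.val + 1) = psum g t.val + g t := by
  have : g t = ∑ s : Fin n, if s = t then g s else 0 := by simp
  rw [this, psum, psum, ← Finset.sum_add_distrib]
  apply Finset.sum_congr rfl
  intro s _
  rcases lt_trichotomy s t with h | h | h
  · have h' : s.val < t.val := h
    simp [h', h.ne, Nat.lt_succ_of_lt h']
  · subst h; simp
  · have h' : t.val < s.val := h
    have : ¬ s.val < t.val + 1 := by omega
    simp [this, h.ne', not_lt_of_gt h]

namespace RootedForest

variable {n : ℕ}

/-- increment of the token `o` caused by the `s`-th swap -/
noncomputable def inc (F : RootedForest (Fin n)) (o : Option (Fin n)) (s : Fin n) : ℤ :=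
  ((if o = some s then 1 else 0) - (if F.parent s = o then 1 else 0)) * (F.h s : ℤ)

/-- location of the token `o` at time `t`, with starting locations `S` -/
noncomputable def lc (F : RootedForest (Fin n)) (S : Option (Fin n) → ℤ) (o : Option (Fin n))
    (t : ℕ) : ℤ := S o + psum (F.inc o) t

/-- consistency of the starting locations -/
def IsStart (F : RootedForest (Fin n)) (S : Option (Fin n) → ℤ) : Prop :=
  S none = n ∧ ∀ v, S (some v) = F.lc S (F.parent v) v.val - F.hR v - 1

lemma lc_zero (F : RootedForest (Fin n)) (S : Option (Fin n) → ℤ) (o : Option (Fin n)) :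
    F.lc S o 0 = S o := by simp [lc, psum_zero]

lemma lc_succ (F : RootedForest (Fin n)) (S : Option (Fin n) → ℤ) (o : Option (Fin n))
    (t : Fin n) : F.lc S o (t.val + 1) = F.lc S o t.val + F.inc o t := by
  simp [lc, psum_succ, add_assoc]

lemma exists_start (F : RootedForest (Fin n)) : ∃ S, F.IsStart S := by
  let step : (v : Fin n) → ((p : Fin n) → F.parent v = some p → ℤ) → ℤ := fun v IH =>
    (match h : F.parent v with
      | none => (n : ℤ)
      | some p => IH p h) + psum (F.inc (F.parent v)) v.val - F.hR v - 1
  let g : Fin n → ℤ := F.wf_parent.fix step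
  have hg : ∀ v, g v = step v (fun p _ => g p) := fun v => F.wf_parent.fix_eq step v
  refine ⟨fun o => o.elim (n : ℤ) g, rfl, ?_⟩
  intro v
  change g v = _
  rw [hg]
  simp only [step, lc]
  congr 3
  split <;> rename_i h <;> simp [h]

lemma start_unique (F : RootedForest (Fin n)) {S S' : Option (Fin n) → ℤ} (h : F.IsStart S)
    (h' : F.IsStart S') : S = S' := by
  have key : ∀ v, S (some v) = S' (some v) := by
    intro v
    induction v using F.wf_parent.induction with
    | _ v ih =>
      rw [h.2, h'.2, lc, lc]
      congr 3
      cases hp : F.parent v with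
      | none => rw [h.1, h'.1]
      | some p => exact ih p hp
  funext o
  cases o with
  | none => rw [h.1, h'.1]
  | some v => exact key v

lemma lc_self (F : RootedForest (Fin n)) (S : Option (Fin n) → ℤ) (v : Fin n) :
    F.lc S (some v) v.val = S (some v) - F.hL v := by
  rw [lc, sub_eq_add_neg]
  congr 1
  rw [hL, psum, Finset.sum_filter]
  push_cast
  rw [← Finset.sum_neg_distrib]
  apply Finset.sum_congr rfl
  intro s _
  by_cases h : s < v
  · have h' : s.val < v.val := h
    have h2 : v ≠ s := h.ne'
    simp only [inc, h, h', and_true, if_true, Option.some.injEq, h2, if_false]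
    split_ifs <;> simp
  · have h' : ¬ s.val < v.val := h
    simp [h, h']

lemma lc_all (F : RootedForest (Fin n)) (S : Option (Fin n) → ℤ) (v : Fin n) :
    F.lc S (some v) n = S (some v) + 1 := by
  have h := F.h_rec v
  rw [lc, psum_all]
  congr 1
  have h1 : ∀ s, F.inc (some v) s = (if v = s then (F.h s : ℤ) else 0) -
      (if F.parent s = some v then (F.h s : ℤ) else 0) := by
    intro s
    simp only [inc, Option.some.injEq]
    split_ifs <;> simp
  simp only [h1, Finset.sum_sub_distrib]
  rw [Finset.sum_ite_eq, ← Finset.sum_filter]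
  simp only [kids] at h
  rw [h]
  push_cast
  simp

lemma lc_all_none (F : RootedForest (Fin n)) (S : Option (Fin n) → ℤ) :
    F.lc S none n = S none - n := by
  rw [lc, psum_all, sub_eq_add_neg]
  congr 1
  rw [← F.sum_roots, kids, Finset.sum_filter, ← Finset.sum_neg_distrib]
  apply Finset.sum_congr rfl
  intro s _
  simp only [inc]
  split_ifs <;> simp_all

lemma lc_anti (F : RootedForest (Fin n)) (S : Option (Fin n) → ℤ) (o : Option (Fin n))
    {t t' : ℕ} (htt : t ≤ t') (hn : t' ≤ n)
    (ho : ∀ s : Fin n, o = some s → s.val < t ∨ t' ≤ s.val) : F.lc S o t' ≤ F.lc S o t := by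
  induction t', htt using Nat.le_induction with
  | base => exact le_rfl
  | succ m hm ih =>
    have h1 := F.lc_succ S o ⟨m, by omega⟩
    have h2 := ih (by omega) (fun s hs => by have := ho s hs; omega)
    have h3 : F.inc o ⟨m, by omega⟩ ≤ 0 := by
      have : o ≠ some ⟨m, by omega⟩ := by
        intro h
        have := ho _ h
        simp at this
        omega
      simp only [inc, this, if_false]
      split_ifs <;> simp
    simp only at h1
    linarith

/-- lower end of arc `v` -/
noncomputable def lo (F : RootedForest (Fin n)) (S : Option (Fin n) → ℤ) (v : Fin n) : ℤ :=
  F.lc S (F.parent v) v.val - F.h v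

/-- upper end of arc `v` -/
noncomputable def hi (F : RootedForest (Fin n)) (S : Option (Fin n) → ℤ) (v : Fin n) : ℤ :=
  F.lc S (F.parent v) v.val

lemma lo_lt_hi (F : RootedForest (Fin n)) (S : Option (Fin n) → ℤ) (v : Fin n) :
    F.lo S v < F.hi S v := by
  have := F.h_pos v
  simp only [lo, hi]
  omega

section
variable {F : RootedForest (Fin n)} {S : Option (Fin n) → ℤ}

lemma IsStart.lo_eq (h : F.IsStart S) (v : Fin n) : F.lo S v = S (some v) - F.hL v := by
  have h1 := h.2 v
  have h2 := F.h_eq_LR v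
  simp only [lo]
  omega

lemma IsStart.hi_eq (h : F.IsStart S) (v : Fin n) : F.hi S v = S (some v) + 1 + F.hR v := by
  have h1 := h.2 v
  simp only [hi]
  omega

lemma IsStart.lc_self_lo (h : F.IsStart S) (v : Fin n) : F.lc S (some v) v.val = F.lo S v := by
  rw [lc_self, h.lo_eq]

lemma inc_self (F : RootedForest (Fin n)) (v : Fin n) : F.inc (some v) v = F.h v := by
  have : F.parent v ≠ some v := fun h => F.kid_ne h rfl
  simp [inc, this]

lemma inc_parent (F : RootedForest (Fin n)) (v : Fin n) : F.inc (F.parent v) v = - F.h v := by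
  have : F.parent v ≠ some v := fun h => F.kid_ne h rfl
  simp [inc, this]

lemma inc_other (F : RootedForest (Fin n)) (v : Fin n) (o : Option (Fin n)) (h1 : o ≠ some v)
    (h2 : o ≠ F.parent v) : F.inc o v = 0 := by
  simp [inc, h1, h2.symm]

lemma IsStart.lc_self_hi (h : F.IsStart S) (v : Fin n) :
    F.lc S (some v) (v.val + 1) = F.hi S v := by
  rw [lc_succ, h.lc_self_lo, inc_self]
  simp [lo, hi]

lemma lc_parent_hi (F : RootedForest (Fin n)) (S : Option (Fin n) → ℤ) (v : Fin n) :
    F.lc S (F.parent v) v.val = F.hi S v := rfl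

lemma lc_parent_lo (F : RootedForest (Fin n)) (S : Option (Fin n) → ℤ) (v : Fin n) :
    F.lc S (F.parent v) (v.val + 1) = F.lo S v := by
  rw [lc_succ, inc_parent]
  simp [lo, sub_eq_add_neg]

lemma IsStart.kid_lt (h : F.IsStart S) {w v : Fin n} (hp : F.parent w = some v) (hw : w < v) :
    F.lo S v ≤ F.lo S w ∧ F.hi S w ≤ S (some v) := by
  have hw' : w.val < v.val := hw
  rw [← h.lc_self_lo v, ← lc_parent_lo, ← lc_parent_hi, hp, ← F.lc_zero S (some v)]
  constructor
  · apply lc_anti _ _ _ (by omega) (by omega)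
    intro s hs; cases hs; omega
  · apply lc_anti _ _ _ (by omega) (by omega)
    intro s hs; cases hs; omega

lemma IsStart.kid_gt (h : F.IsStart S) {w v : Fin n} (hp : F.parent w = some v) (hw : v < w) :
    S (some v) + 1 ≤ F.lo S w ∧ F.hi S w ≤ F.hi S v := by
  have hw' : v.val < w.val := hw
  rw [← h.lc_self_hi v, ← lc_parent_lo, ← lc_parent_hi, hp, ← F.lc_all S v]
  constructor
  · apply lc_anti _ _ _ (by omega) (by omega)
    intro s hs; cases hs; omega
  · apply lc_anti _ _ _ (by omega) (by omega)
    intro s hs; cases hs; omega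

lemma IsStart.root (h : F.IsStart S) {w : Fin n} (hp : F.parent w = none) :
    0 ≤ F.lo S w ∧ F.hi S w ≤ n := by
  have h0 := F.lc_zero S none
  have h1 := F.lc_all_none S
  rw [h.1] at h0 h1
  rw [← lc_parent_lo, ← lc_parent_hi, hp]
  constructor
  · have := F.lc_anti S none (t := w.val + 1) (t' := n) (by omega) (by omega) (by simp)
    linarith
  · have := F.lc_anti S none (t := 0) (t' := w.val) (by omega) (by omega) (by simp)
    linarith

lemma IsStart.mem (h : F.IsStart S) (v : Fin n) :
    F.lo S v ≤ S (some v) ∧ S (some v) < F.hi S v := by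
  rw [h.lo_eq, h.hi_eq]; omega

lemma IsStart.kid (h : F.IsStart S) {w v : Fin n} (hp : F.parent w = some v) :
    F.lo S v ≤ F.lo S w ∧ F.hi S w ≤ F.hi S v := by
  have := h.mem v
  rcases lt_trichotomy w v with hw | hw | hw
  · have := h.kid_lt hp hw
    omega
  · exact absurd hw (F.kid_ne hp)
  · have := h.kid_gt hp hw
    omega

lemma IsStart.dsc (h : F.IsStart S) (w v : Fin n) (hd : w ∈ F.dsc v) :
    F.lo S v ≤ F.lo S w ∧ F.hi S w ≤ F.hi S v := by
  induction w using F.wf_parent.induction with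
  | _ w ih =>
    obtain ⟨p, hp, h1⟩ := (F.mem_dsc_head w v).1 hd
    have h2 := h.kid hp
    rcases h1 with rfl | h1
    · exact h2
    · have := ih p hp h1
      omega

lemma IsStart.bounds (h : F.IsStart S) (w : Fin n) : 0 ≤ F.lo S w ∧ F.hi S w ≤ n := by
  induction w using F.wf_parent.induction with
  | _ w ih =>
    cases hp : F.parent w with
    | none => exact h.root hp
    | some p =>
      have h1 := ih p hp
      have h2 := h.kid hp
      omega

lemma IsStart.sib (h : F.IsStart S) {w w' : Fin n} (hp : F.parent w = F.parent w') (hw : w < w') :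
    F.hi S w ≤ F.lo S w' ∨ F.hi S w' ≤ F.lo S w := by
  have hw' : w.val < w'.val := hw
  by_cases hv : ∃ v, F.parent w = some v ∧ w < v ∧ v < w'
  · obtain ⟨v, h1, h2, h3⟩ := hv
    have h4 := h.kid_lt h1 h2
    have h5 := h.kid_gt (hp ▸ h1) h3
    left; omega
  · right
    rw [← lc_parent_lo, ← lc_parent_hi, ← hp]
    apply lc_anti _ _ _ (by omega) (by omega)
    intro s hs
    by_contra hc
    apply hv
    refine ⟨s, hs, ?_, ?_⟩
    · have : w ≠ s := F.kid_ne hs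
      omega
    · omega

lemma IsStart.sib' (h : F.IsStart S) {w w' : Fin n} (hp : F.parent w = F.parent w') (hw : w ≠ w') :
    F.hi S w ≤ F.lo S w' ∨ F.hi S w' ≤ F.lo S w := by
  rcases lt_or_gt_of_ne hw with hw | hw
  · exact h.sib hp hw
  · exact (h.sib hp.symm hw).symm

lemma exists_root (F : RootedForest (Fin n)) (v : Fin n) :
    ∃ w, F.parent w = none ∧ (v = w ∨ v ∈ F.dsc w) := by
  induction v using F.wf_parent.induction with
  | _ v ih =>
    cases hp : F.parent v with
    | none => exact ⟨v, hp, Or.inl rfl⟩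
    | some p =>
      obtain ⟨w, h1, h2⟩ := ih p hp
      refine ⟨w, h1, Or.inr ?_⟩
      rw [mem_dsc_head]
      exact ⟨p, hp, h2⟩

lemma IsStart.trich (h : F.IsStart S) (u v : Fin n) :
    u = v ∨ u ∈ F.dsc v ∨ v ∈ F.dsc u ∨ F.hi S u ≤ F.lo S v ∨ F.hi S v ≤ F.lo S u := by
  induction u using F.wf_parent.induction with
  | _ u ih =>
    -- the sibling-type argument
    have key : ∀ w, F.parent u = F.parent w → (v = w ∨ v ∈ F.dsc w) →
        u = v ∨ u ∈ F.dsc v ∨ v ∈ F.dsc u ∨ F.hi S u ≤ F.lo S v ∨ F.hi S v ≤ F.lo S u := by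
      intro w hw hv
      by_cases huw : u = w
      · subst huw
        rcases hv with hv | hv
        · exact Or.inl hv.symm
        · exact Or.inr (Or.inr (Or.inl hv))
      · have h1 := h.sib' hw huw
        rcases hv with rfl | hv
        · exact Or.inr (Or.inr (Or.inr h1))
        · have h2 := h.dsc v w hv
          right; right; right
          omega
    cases hp : F.parent u with
    | none =>
      obtain ⟨w, h1, h2⟩ := F.exists_root v
      exact key w (hp.trans h1.symm) h2
    | some p =>
      rcases ih p hp with rfl | h1 | h1 | h1
      · exact Or.inr (Or.inl (F.kid_mem_dsc hp))
      · exact Or.inr (Or.inl (F.dsc_trans (F.kid_mem_dsc hp) h1))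
      · obtain ⟨c, hc, h2⟩ := (F.mem_dsc_tail v p).1 h1
        exact key c (hp.trans hc.symm) h2
      · have h2 := h.kid hp
        right; right; right
        omega

lemma IsStart.dsc_ne (h : F.IsStart S) {u v : Fin n} (hd : u ∈ F.dsc v) :
    S (some u) ≠ S (some v) := by
  obtain ⟨c, hc, h2⟩ := (F.mem_dsc_tail u v).1 hd
  have h3 : F.lo S c ≤ S (some u) ∧ S (some u) < F.hi S c := by
    have := h.mem u
    rcases h2 with rfl | h2
    · exact this
    · have := h.dsc u c h2
      omega
  rcases lt_trichotomy c v with hw | hw | hw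
  · have := h.kid_lt hc hw
    omega
  · exact absurd hw (F.kid_ne hc)
  · have := h.kid_gt hc hw
    omega

lemma IsStart.inj (h : F.IsStart S) : Function.Injective S := by
  have key : ∀ v, S (some v) < S none := by
    intro v
    have h1 := h.mem v
    have h2 := h.bounds v
    rw [h.1]; omega
  intro o o' ho
  cases o with
  | none =>
    cases o' with
    | none => rfl
    | some v => have := key v; omega
  | some u =>
    cases o' with
    | none => have := key u; omega
    | some v =>
      congr 1
      by_contra hne
      have h1 := h.mem u
      have h2 := h.mem v
      rcases h.trich u v with h3 | h3 | h3 | h3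
      · exact hne h3
      · exact h.dsc_ne h3 ho
      · exact h.dsc_ne h3 ho.symm
      · omega

lemma IsStart.range (h : F.IsStart S) (o : Option (Fin n)) : 0 ≤ S o ∧ S o ≤ n := by
  cases o with
  | none => rw [h.1]; omega
  | some v =>
    have h1 := h.mem v
    have h2 := h.bounds v
    omega

end

end RootedForest
/-- partial products -/
def Qp {n : ℕ} {α : Type} (g : Fin n → Equiv.Perm α) : ℕ → Equiv.Perm α
  | 0 => 1
  | t + 1 => (if h : t < n then g ⟨t, h⟩ else 1) * Qp g t

lemma Qp_succ {n : ℕ} {α : Type} (g : Fin n → Equiv.Perm α) (t : Fin n) (x : α) :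
    Qp g (t.val + 1) x = g t (Qp g t.val x) := by
  simp [Qp]

lemma Qp_castSucc {n : ℕ} {α : Type} (g : Fin (n + 1) → Equiv.Perm α) (t : ℕ) (ht : t ≤ n) :
    Qp g t = Qp (fun i : Fin n => g i.castSucc) t := by
  induction t with
  | zero => rfl
  | succ t ih =>
    have h1 : t < n := by omega
    have h2 : t < n + 1 := by omega
    simp only [Qp, h1, h2, dif_pos]
    rw [ih (by omega)]
    rfl

lemma Qp_all {n : ℕ} {α : Type} (g : Fin n → Equiv.Perm α) :
    (List.ofFn g).reverse.prod = Qp g n := by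
  induction n with
  | zero => simp [Qp]
  | succ n ih =>
    rw [List.ofFn_succ', List.concat_eq_append, List.reverse_append, List.prod_append, ih]
    simp only [Qp, List.reverse_singleton, List.prod_singleton]
    rw [Qp_castSucc g n le_rfl]
    simp [Fin.last]

/-- the arcs `(a,b)` are the arcs of the forest `F` -/
def ArcRel {n : ℕ} (a b : Fin n → Fin (n + 1)) (F : RootedForest (Fin n))
    (S : Option (Fin n) → ℤ) : Prop :=
  F.IsStart S ∧ ∀ v, ((a v).val : ℤ) = F.lo S v ∧ ((b v).val : ℤ) = F.hi S v

section
variable {n : ℕ} {a b : Fin n → Fin (n + 1)} {F : RootedForest (Fin n)} {S : Option (Fin n) → ℤ}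

lemma RootedForest.IsStart.exists_tok (h : F.IsStart S) (o : Option (Fin n)) :
    ∃ x : Fin (n + 1), (x.val : ℤ) = S o := by
  have := h.range o
  exact ⟨⟨(S o).toNat, by omega⟩, by simp; omega⟩

lemma RootedForest.IsStart.exists_opt (h : F.IsStart S) (x : Fin (n + 1)) :
    ∃ o, (x.val : ℤ) = S o := by
  choose tok htok using h.exists_tok
  have hinj : Function.Injective tok := by
    intro o o' ho
    apply h.inj
    rw [← htok, ← htok, ho]
  have hb : Function.Bijective tok := by
    rw [Fintype.bijective_iff_injective_and_card]
    exact ⟨hinj, by simp⟩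
  obtain ⟨o, rfl⟩ := hb.2 x
  exact ⟨o, htok o⟩

lemma ArcRel.trace (h : ArcRel a b F S) (t : ℕ) (ht : t ≤ n) :
    ∀ (o : Option (Fin n)) (x : Fin (n + 1)), (x.val : ℤ) = S o →
      ((Qp (fun i => Equiv.swap (a i) (b i)) t x).val : ℤ) = F.lc S o t := by
  induction t with
  | zero => intro o x hx; simpa [Qp, F.lc_zero] using hx
  | succ t ih =>
    intro o x hx
    have ih := ih (by omega)
    set t' : Fin n := ⟨t, by omega⟩ with ht'
    have hQ := Qp_succ (fun i => Equiv.swap (a i) (b i)) t' x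
    change Qp _ (t + 1) x = Equiv.swap (a t') (b t') (Qp _ t x) at hQ
    rw [hQ]
    obtain ⟨y, hy⟩ := h.1.exists_tok (some t')
    obtain ⟨z, hz⟩ := h.1.exists_tok (F.parent t')
    have hy2 : Qp (fun i => Equiv.swap (a i) (b i)) t y = a t' := by
      apply Fin.ext
      have h1 := ih _ y hy
      have h2 := h.1.lc_self_lo t'
      have h3 := (h.2 t').1
      simp only [ht'] at h1 h2 h3 ⊢
      omega
    have hz2 : Qp (fun i => Equiv.swap (a i) (b i)) t z = b t' := by
      apply Fin.ext
      have h1 := ih _ z hz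
      have h2 := F.lc_parent_hi S t'
      have h3 := (h.2 t').2
      simp only [ht'] at h1 h2 h3 ⊢
      omega
    by_cases ho1 : o = some t'
    · rw [ho1] at hx ⊢
      have hxy : x = y := by apply Fin.ext; omega
      rw [hxy, hy2, Equiv.swap_apply_left, (h.2 t').2, ← h.1.lc_self_hi]
    · by_cases ho2 : o = F.parent t'
      · rw [ho2] at hx ⊢
        have hxz : x = z := by apply Fin.ext; omega
        rw [hxz, hz2, Equiv.swap_apply_right, (h.2 t').1, ← F.lc_parent_lo]
      · rw [Equiv.swap_apply_of_ne_of_ne]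
        · have h4 := F.lc_succ S o t'
          rw [F.inc_other t' o ho1 ho2, add_zero] at h4
          rw [ih o x hx]
          exact h4.symm
        · rw [← hy2]
          intro he
          have := (Qp (fun i => Equiv.swap (a i) (b i)) t).injective he
          subst this
          exact ho1 (h.1.inj (hx.symm.trans hy))
        · rw [← hz2]
          intro he
          have := (Qp (fun i => Equiv.swap (a i) (b i)) t).injective he
          subst this
          exact ho2 (h.1.inj (hx.symm.trans hz))

lemma ArcRel.prod_eq (h : ArcRel a b F S) :
    (List.ofFn (fun i => Equiv.swap (a i) (b i))).reverse.prod = finRotate (n + 1) := by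
  rw [Qp_all]
  ext x
  obtain ⟨o, ho⟩ := h.1.exists_opt x
  have h1 := h.trace n le_rfl o x ho
  cases o with
  | none =>
    rw [h.1.1] at ho
    have : x = Fin.last n := by apply Fin.ext; simp; omega
    rw [F.lc_all_none, h.1.1] at h1
    rw [this] at h1
    rw [this, finRotate_last]
    have h0 : ((0 : Fin (n + 1)) : ℕ) = 0 := rfl
    rw [h0]
    omega
  | some v =>
    rw [F.lc_all] at h1
    have h2 := h.1.mem v
    have h3 := h.1.bounds v
    have : x ≠ Fin.last n := by
      rintro rfl
      simp at ho
      omega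
    rw [coe_finRotate_of_ne_last this]
    omega

lemma ArcRel.forest_unique {G : RootedForest (Fin n)} {S' : Option (Fin n) → ℤ}
    (h : ArcRel a b F S) (h' : ArcRel a b G S') : F = G := by
  have hS : S = S' := by
    funext o
    cases o with
    | none => rw [h.1.1, h'.1.1]
    | some t =>
      obtain ⟨x, hx⟩ := h.1.exists_tok (some t)
      obtain ⟨y, hy⟩ := h'.1.exists_tok (some t)
      have h1 := h.trace t.val (by omega) _ x hx
      have h2 := h'.trace t.val (by omega) _ y hy
      rw [h.1.lc_self_lo, ← (h.2 t).1] at h1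
      rw [h'.1.lc_self_lo, ← (h'.2 t).1, ← h1] at h2
      have h3 := (Qp (fun i => Equiv.swap (a i) (b i)) t.val).injective (Fin.ext (by exact_mod_cast h2))
      rw [← hx, ← hy, h3]
  subst hS
  have hp : F.parent = G.parent := by
    funext t
    obtain ⟨x, hx⟩ := h.1.exists_tok (F.parent t)
    obtain ⟨y, hy⟩ := h'.1.exists_tok (G.parent t)
    have h1 := h.trace t.val (by omega) _ x hx
    have h2 := h'.trace t.val (by omega) _ y hy
    rw [F.lc_parent_hi, ← (h.2 t).2] at h1
    rw [G.lc_parent_hi, ← (h'.2 t).2, ← h1] at h2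
    have h3 := (Qp (fun i => Equiv.swap (a i) (b i)) t.val).injective (Fin.ext (by exact_mod_cast h2))
    apply h.1.inj
    rw [← hx, ← hy, h3]
  cases F; cases G
  simp only [RootedForest.mk.injEq]
  exact hp

lemma ArcRel.exists_fact (F : RootedForest (Fin n)) :
    ∃ (f : MinFact n) (S : Option (Fin n) → ℤ), ArcRel f.a f.b F S := by
  obtain ⟨S, hS⟩ := F.exists_start
  have hb := hS.bounds
  have hlt := F.lo_lt_hi S
  have hrel : ArcRel (fun v => (⟨(F.lo S v).toNat, by have := hb v; have := hlt v; omega⟩ : Fin (n + 1)))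
      (fun v => (⟨(F.hi S v).toNat, by have := hb v; have := hlt v; omega⟩ : Fin (n + 1))) F S := by
    refine ⟨hS, fun v => ?_⟩
    have := hb v
    have := hlt v
    simp only
    omega
  refine ⟨⟨_, _, ?_, hrel.prod_eq⟩, S, hrel⟩
  intro v
  have := hb v
  have := hlt v
  rw [Fin.lt_def]
  simp only
  omega

lemma sum_start (h : F.IsStart S) : ∑ v, S (some v) = (n.choose 2 : ℤ) := by
  have h1 : ∑ o, S o = ∑ x : Fin (n + 1), (x.val : ℤ) := by
    choose tok htok using h.exists_tok
    have hinj : Function.Injective tok := by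
      intro o o' ho
      apply h.inj
      rw [← htok, ← htok, ho]
    have hb : Function.Bijective tok := by
      rw [Fintype.bijective_iff_injective_and_card]
      exact ⟨hinj, by simp⟩
    rw [← hb.sum_comp (fun x : Fin (n + 1) => (x.val : ℤ))]
    exact Finset.sum_congr rfl (fun o _ => (htok o).symm)
  rw [Fintype.sum_option, h.1, Fin.sum_univ_castSucc] at h1
  simp only [Fin.val_castSucc, Fin.val_last] at h1
  have h2 : ∑ x : Fin n, (x.val : ℤ) = (n.choose 2 : ℤ) := by
    rw [Nat.choose_two_right, ← Finset.sum_range_id, Finset.sum_range]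
    push_cast
    rfl
  linarith

lemma ArcRel.area_eq {f : MinFact n} (h : ArcRel f.a f.b F S) :
    (F.maj : ℤ) = f.area ∧ (F.comaj : ℤ) = f.coarea := by
  have h1 := sum_start h.1
  have ha : ∀ i, ((f.a i).val : ℤ) = S (some i) - F.hL i := fun i => by
    rw [(h.2 i).1, h.1.lo_eq]
  have hb : ∀ i, ((f.b i).val : ℤ) - 1 = S (some i) + F.hR i := fun i => by
    rw [(h.2 i).2, h.1.hi_eq]; ring
  simp only [MinFact.area, MinFact.coarea, RootedForest.maj, RootedForest.comaj]
  rw [Finset.sum_congr rfl (fun i _ => ha i), Finset.sum_congr rfl (fun i _ => hb i),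
    Finset.sum_sub_distrib, Finset.sum_add_distrib, h1]
  push_cast
  constructor <;> ring

end
section
variable {n : ℕ}

lemma val_swap {m : ℕ} (a b x : Fin m) (hab : a ≠ b) : (((Equiv.swap a b) x).val : ℤ) =
    x.val + ((if x = a then 1 else 0) - (if x = b then 1 else 0)) * ((b.val : ℤ) - a.val) := by
  by_cases h1 : x = a
  · subst h1; simp [hab]
  · by_cases h2 : x = b
    · subst h2; simp [h1]
    · simp [h1, h2, Equiv.swap_apply_of_ne_of_ne]

lemma exists_forest (f : MinFact n) : ∃ (F : RootedForest (Fin n)) (S : Option (Fin n) → ℤ),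
    ArcRel f.a f.b F S := by
  set g : Fin n → Equiv.Perm (Fin (n + 1)) := fun i => Equiv.swap (f.a i) (f.b i) with hg
  have hprod : Qp g n = finRotate (n + 1) := by rw [← Qp_all]; exact f.prod_eq
  let u : Fin n → Fin (n + 1) := fun t => (Qp g t.val).symm (f.a t)
  let p : Fin n → Fin (n + 1) := fun t => (Qp g t.val).symm (f.b t)
  let D : Fin n → ℤ := fun t => (f.b t).val - (f.a t).val
  have hD : ∀ t, 0 < D t := fun t => by
    have : (f.a t).val < (f.b t).val := f.ab_lt t
    simp only [D]; omega
  -- trajectories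
  have htr : ∀ (x : Fin (n + 1)) (t : ℕ), t ≤ n → ((Qp g t x).val : ℤ) =
      x.val + psum (fun s => ((if x = u s then 1 else 0) - (if x = p s then 1 else 0)) * D s) t := by
    intro x t ht
    induction t with
    | zero => simp [Qp, psum_zero]
    | succ t ih =>
      have h1 := Qp_succ g ⟨t, by omega⟩ x
      have h2 := psum_succ
        (fun s => ((if x = u s then 1 else 0) - (if x = p s then 1 else 0)) * D s) ⟨t, by omega⟩
      simp only at h1 h2
      rw [h1, h2, ← add_assoc, ← ih (by omega), val_swap _ _ _ (f.ab_lt _).ne]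
      simp only [u, p, D, Equiv.eq_symm_apply]
  -- every token but the last moves up
  have hsurj : ∀ x : Fin n, ∃ t, u t = x.castSucc := by
    intro x
    by_contra hc
    push Not at hc
    have h1 := htr x.castSucc n le_rfl
    rw [hprod, coe_finRotate_of_ne_last (Fin.castSucc_lt_last x).ne, psum_all] at h1
    have h2 : ∑ s, ((if x.castSucc = u s then (1 : ℤ) else 0) -
        (if x.castSucc = p s then 1 else 0)) * D s ≤ 0 := by
      apply Finset.sum_nonpos
      intro s _
      have := hD s
      rw [if_neg (hc s).symm]
      split_ifs <;> simp <;> omega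
    push_cast at h1
    omega
  choose s hs using hsurj
  have hsinj : Function.Injective s := by
    intro x y hxy
    apply Fin.castSucc_injective
    rw [← hs, ← hs, hxy]
  have hsb := Finite.surjective_of_injective hsinj
  -- the token bijection
  let tok : Option (Fin n) → Fin (n + 1) := fun o => o.elim (Fin.last n) u
  have htokinj : Function.Injective tok := by
    have h1 : ∀ t, u t ≠ Fin.last n := by
      intro t
      obtain ⟨x, rfl⟩ := hsb t
      rw [hs]
      exact (Fin.castSucc_lt_last x).ne
    intro o o' ho
    cases o with
    | none =>
      cases o' with
      | none => rfl
      | some v => exact absurd ho.symm (h1 v)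
    | some w =>
      cases o' with
      | none => exact absurd ho (h1 w)
      | some v =>
        obtain ⟨x, rfl⟩ := hsb w
        obtain ⟨y, rfl⟩ := hsb v
        change u (s x) = u (s y) at ho
        rw [hs, hs] at ho
        rw [Fin.castSucc_injective _ ho]
  have htokb : Function.Bijective tok := by
    rw [Fintype.bijective_iff_injective_and_card]
    exact ⟨htokinj, by simp⟩
  choose par hpar using fun t => htokb.2 (p t)
  have htr2 : ∀ (o : Option (Fin n)) (t : ℕ), t ≤ n → ((Qp g t (tok o)).val : ℤ) =
      (tok o).val + psum (fun s => ((if o = some s then 1 else 0) -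
        (if par s = o then 1 else 0)) * D s) t := by
    intro o t ht
    rw [htr (tok o) t ht]
    congr 2
    funext s
    have h1 : tok o = u s ↔ o = some s := by
      change tok o = tok (some s) ↔ _
      exact htokinj.eq_iff
    have h2 : tok o = p s ↔ par s = o := by
      rw [← hpar, htokinj.eq_iff, eq_comm]
    simp only [h1, h2]
  have hDrec : ∀ v, D v = 1 + ∑ w ∈ Finset.univ.filter (fun w => par w = some v), D w := by
    intro v
    have h1 := htr2 (some v) n le_rfl
    have h2 : tok (some v) ≠ Fin.last n := fun h => by
      have := htokinj (a₁ := some v) (a₂ := none) h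
      simp at this
    rw [hprod, coe_finRotate_of_ne_last h2, psum_all] at h1
    simp only [sub_mul, Finset.sum_sub_distrib, Option.some.injEq, ite_mul, one_mul, zero_mul,
      Finset.sum_ite_eq, Finset.mem_univ, if_true] at h1
    rw [Finset.sum_filter]
    push_cast at h1
    linarith
  have hDlt : ∀ v w, par w = some v → D w < D v := by
    intro v w hw
    have h1 := Finset.single_le_sum (f := D) (s := Finset.univ.filter (fun w => par w = some v))
      (fun i _ => (hD i).le) (by simpa using hw : w ∈ _)
    have := hDrec v
    omega
  let F : RootedForest (Fin n) := ⟨par, by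
    intro v hv
    have : ∀ x y, Relation.TransGen (fun a b => par a = some b) x y → D x < D y := by
      intro x y hxy
      induction hxy with
      | single h => exact hDlt _ _ h
      | tail _ h ih => exact ih.trans (hDlt _ _ h)
    exact lt_irrefl _ (this v v hv)⟩
  have hDh : ∀ v, D v = F.h v := by
    have : ∀ (k : ℕ) v, D v ≤ k → D v = F.h v := by
      intro k
      induction k with
      | zero => intro v hv; have := hD v; push_cast at hv; omega
      | succ k ih =>
        intro v hv
        rw [hDrec, F.h_rec]
        push_cast
        congr 1
        apply Finset.sum_congr rfl
        intro w hw
        apply ih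
        have := hDlt v w (by simpa using hw)
        push_cast at hv
        omega
    intro v
    exact this (D v).toNat v (by have := hD v; omega)
  let S : Option (Fin n) → ℤ := fun o => ((tok o).val : ℤ)
  have hlc : ∀ o t, t ≤ n → ((Qp g t (tok o)).val : ℤ) = F.lc S o t := by
    intro o t ht
    rw [htr2 o t ht]
    simp only [RootedForest.lc, RootedForest.inc, hDh]
    rfl
  have hb : ∀ t, ((f.b t).val : ℤ) = F.hi S t := by
    intro t
    have h1 := hlc (par t) t.val (by omega)
    rw [hpar] at h1
    simp only [p, Equiv.apply_symm_apply] at h1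
    exact h1
  have ha : ∀ t, ((f.a t).val : ℤ) = F.lo S t := by
    intro t
    have h1 := hb t
    have h2 := hDh t
    simp only [RootedForest.lo, RootedForest.hi, D] at *
    omega
  refine ⟨F, S, ⟨?_, ?_⟩, fun v => ⟨ha v, hb v⟩⟩
  · simp [S, tok]
  · intro v
    have h1 := hlc (some v) v.val (by omega)
    have h2 : Qp g v.val (tok (some v)) = f.a v := by simp [tok, u]
    rw [h2, F.lc_self, ha] at h1
    have h3 := F.h_eq_LR v
    simp only [RootedForest.lo] at h1
    omega

/-- The bijection matching (area, coarea) with (maj, comaj). -/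
lemma exists_maj_equiv (n : ℕ) : ∃ e : MinFact n ≃ RootedForest (Fin n),
    ∀ f, ((e f).maj : ℤ) = f.area ∧ ((e f).comaj : ℤ) = f.coarea := by
  choose φ S h using exists_forest (n := n)
  have hb : Function.Bijective φ := by
    constructor
    · intro f f' hff
      have h1 := h f
      have h2 := h f'
      rw [← hff] at h2
      have hS := (φ f).start_unique h1.1 h2.1
      have ha : f.a = f'.a := by
        funext v
        apply Fin.ext
        have h3 := (h1.2 v).1
        have h4 := (h2.2 v).1
        rw [hS] at h3
        omega
      have hb : f.b = f'.b := by
        funext v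
        apply Fin.ext
        have h3 := (h1.2 v).2
        have h4 := (h2.2 v).2
        rw [hS] at h3
        omega
      cases f; cases f'
      simp only [MinFact.mk.injEq]
      exact ⟨ha, hb⟩
    · intro F
      obtain ⟨f, S', hf⟩ := ArcRel.exists_fact F
      exact ⟨f, (h f).forest_unique hf⟩
  refine ⟨Equiv.ofBijective φ hb, fun f => ?_⟩
  exact (h f).area_eq

end
/-- rotation of a finite label set: labels `≥ l` come first, labels `< l` come last -/
lemma exists_rot {n : ℕ} (A : Finset (Fin n)) (l : Fin n) : ∃ π : Equiv.Perm (Fin n),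
    (∀ x, x ∉ A → π x = x) ∧ (∀ x, x ∈ A → π x ∈ A) ∧
    ∀ x ∈ A, ∀ y ∈ A, ((if π y < π x then 1 else 0) : ℤ) =
      (if y < x then 1 else 0) + (if x < l then 1 else 0) - (if y < l then 1 else 0) := by
  let key : Fin n → ℕ := fun x => if x < l then n + x.val else x.val
  have hkey : Function.Injective key := by
    intro x y hxy
    simp only [key] at hxy
    apply Fin.ext
    split_ifs at hxy <;> omega
  let K := A.image key
  have hK : K.card = A.card := Finset.card_image_of_injective _ hkey
  let e1 := K.orderIsoOfFin hK
  let e2 := A.orderIsoOfFin rfl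
  let p : {x // x ∈ A} → {x // x ∈ A} := fun x =>
    e2 (e1.symm ⟨key x.1, Finset.mem_image_of_mem key x.2⟩)
  have hp : ∀ x y, p y < p x ↔ key y.1 < key x.1 := by
    intro x y
    simp only [p, OrderIso.lt_iff_lt, Subtype.mk_lt_mk]
  have hpi : Function.Injective p := by
    intro x y hxy
    have := (e1.symm.injective (e2.injective hxy))
    exact Subtype.ext (hkey (congrArg Subtype.val this))
  let p' : Equiv.Perm {x // x ∈ A} := Equiv.ofBijective p (Finite.injective_iff_bijective.1 hpi)
  have hmem : ∀ x (hx : x ∈ A), Equiv.Perm.ofSubtype p' x = (p ⟨x, hx⟩).1 := by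
    intro x hx
    rw [Equiv.Perm.ofSubtype_apply_of_mem p' hx]
    rfl
  refine ⟨Equiv.Perm.ofSubtype p', fun x hx => Equiv.Perm.ofSubtype_apply_of_not_mem p' hx,
    fun x hx => ?_, fun x hx y hy => ?_⟩
  · rw [hmem x hx]; exact (p ⟨x, hx⟩).2
  · have h1 : Equiv.Perm.ofSubtype p' y < Equiv.Perm.ofSubtype p' x ↔ key y < key x := by
      rw [hmem x hx, hmem y hy, Subtype.coe_lt_coe]
      exact hp ⟨x, hx⟩ ⟨y, hy⟩
    simp only [h1, key]
    split_ifs <;> omega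

/-- the chosen rotation -/
noncomputable def rot {n : ℕ} (A : Finset (Fin n)) (l : Fin n) : Equiv.Perm (Fin n) :=
  (exists_rot A l).choose

lemma rot_of_notMem {n : ℕ} (A : Finset (Fin n)) (l x : Fin n) (hx : x ∉ A) : rot A l x = x :=
  (exists_rot A l).choose_spec.1 x hx

lemma rot_mem {n : ℕ} (A : Finset (Fin n)) (l x : Fin n) (hx : x ∈ A) : rot A l x ∈ A :=
  (exists_rot A l).choose_spec.2.1 x hx

lemma rot_lt {n : ℕ} (A : Finset (Fin n)) (l : Fin n) {x y : Fin n} (hx : x ∈ A) (hy : y ∈ A) :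
    ((if rot A l y < rot A l x then 1 else 0) : ℤ) =
      (if y < x then 1 else 0) + (if x < l then 1 else 0) - (if y < l then 1 else 0) :=
  (exists_rot A l).choose_spec.2.2 x hx y hy

namespace RootedForest

variable {n : ℕ}

/-- inversions at `v` for the labelling `σ` -/
noncomputable def invv (F : RootedForest (Fin n)) (σ : Equiv.Perm (Fin n)) (v : Fin n) : ℤ :=
  ∑ u ∈ F.dsc v, if σ u < σ v then 1 else 0

/-- left hook length at `v` for the labelling `σ` -/
noncomputable def hLv (F : RootedForest (Fin n)) (σ : Equiv.Perm (Fin n)) (v : Fin n) : ℤ :=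
  ∑ c ∈ F.kids (some v), (if σ c < σ v then 1 else 0) * (F.h c : ℤ)

/-- renaming of labels at the vertex `v` -/
noncomputable def th (F : RootedForest (Fin n)) (v : Fin n) (σ : Equiv.Perm (Fin n)) :
    Equiv.Perm (Fin n) := rot ((F.dsc v).image σ) (σ v) * σ

lemma th_of_notMem (F : RootedForest (Fin n)) (v : Fin n) (σ : Equiv.Perm (Fin n)) (x : Fin n)
    (hx : x ∉ F.dsc v) : F.th v σ x = σ x := by
  rw [th, Equiv.Perm.mul_apply, rot_of_notMem]
  simpa using hx

lemma th_image (F : RootedForest (Fin n)) (v : Fin n) (σ : Equiv.Perm (Fin n))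
    (T : Finset (Fin n)) (hT : F.dsc v ⊆ T ∨ Disjoint (F.dsc v) T) :
    T.image (F.th v σ) = T.image σ := by
  apply Finset.eq_of_subset_of_card_le
  · intro y hy
    obtain ⟨x, hx, rfl⟩ := Finset.mem_image.1 hy
    by_cases hxv : x ∈ F.dsc v
    · rcases hT with hT | hT
      · apply Finset.image_subset_image hT
        rw [th, Equiv.Perm.mul_apply]
        exact rot_mem _ _ _ (Finset.mem_image_of_mem _ hxv)
      · exact absurd hx (Finset.disjoint_left.1 hT hxv)
    · rw [F.th_of_notMem v σ x hxv]
      exact Finset.mem_image_of_mem _ hx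
  · rw [Finset.card_image_of_injective _ σ.injective,
      Finset.card_image_of_injective _ (F.th v σ).injective]

lemma th_injective (F : RootedForest (Fin n)) (v : Fin n) : Function.Injective (F.th v) := by
  intro σ τ h
  have h1 : σ v = τ v := by
    rw [← F.th_of_notMem v σ v (F.not_mem_dsc_self v), h,
      F.th_of_notMem v τ v (F.not_mem_dsc_self v)]
  have h2 : (F.dsc v).image σ = (F.dsc v).image τ := by
    rw [← F.th_image v σ _ (Or.inl (Finset.Subset.refl _)), h,
      F.th_image v τ _ (Or.inl (Finset.Subset.refl _))]
  rw [th, th, h1, h2] at h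
  exact mul_left_cancel h

lemma invv_eq (F : RootedForest (Fin n)) (σ : Equiv.Perm (Fin n)) (v : Fin n) :
    F.invv σ v = ∑ y ∈ (F.dsc v).image σ, if y < σ v then 1 else 0 := by
  rw [invv, Finset.sum_image (fun _ _ _ _ h => σ.injective h)]

lemma invv_th (F : RootedForest (Fin n)) (v u : Fin n) (σ : Equiv.Perm (Fin n))
    (hu : u ∉ F.dsc v) : F.invv (F.th v σ) u = F.invv σ u := by
  rw [invv_eq, invv_eq, F.th_of_notMem v σ u hu, F.th_image]
  by_cases h : v = u ∨ v ∈ F.dsc u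
  · left
    rcases h with rfl | h
    · exact Finset.Subset.refl _
    · exact F.dsc_subset h
  · right
    rw [Finset.disjoint_left]
    intro x h1 h2
    push Not at h
    rcases F.dsc_comparable h1 h2 with h3 | h3 | h3
    · exact h.1 h3
    · exact h.2 h3
    · exact hu h3

lemma hLv_th (F : RootedForest (Fin n)) (v u : Fin n) (σ : Equiv.Perm (Fin n))
    (hu : u ∉ F.dsc v) (huv : u ≠ v) : F.hLv (F.th v σ) u = F.hLv σ u := by
  apply Finset.sum_congr rfl
  intro c hc
  rw [mem_kids] at hc
  rw [F.th_of_notMem v σ u hu, F.th_of_notMem v σ c]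
  intro h
  obtain ⟨p, hp, h⟩ := (F.mem_dsc_head c v).1 h
  rw [hc] at hp
  cases hp
  rcases h with h | h
  · exact huv h
  · exact hu h

lemma sum_dsc (F : RootedForest (Fin n)) (v : Fin n) (g : Fin n → ℤ) :
    ∑ c ∈ F.dsc v, g c = ∑ c ∈ F.kids (some v), g c +
      ∑ u ∈ F.dsc v, ∑ c ∈ F.kids (some u), g c := by
  have h1 : F.dsc v = (insert v (F.dsc v)).biUnion (fun u => F.kids (some u)) := by
    ext c
    rw [mem_dsc_head]
    simp only [Finset.mem_biUnion, Finset.mem_insert, mem_kids]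
    constructor
    · rintro ⟨p, h1, h2⟩; exact ⟨p, h2, h1⟩
    · rintro ⟨p, h1, h2⟩; exact ⟨p, h2, h1⟩
  rw [← Finset.sum_insert (f := fun u => ∑ c ∈ F.kids (some u), g c) (F.not_mem_dsc_self v)]
  conv_lhs => rw [h1]
  rw [Finset.sum_biUnion]
  intro u _ w _ huw
  rw [Function.onFun, Finset.disjoint_left]
  intro x hx hy
  rw [mem_kids] at hx hy
  rw [hx] at hy
  exact huw (Option.some.inj hy)

lemma hLv_th_key (F : RootedForest (Fin n)) (v : Fin n) (σ : Equiv.Perm (Fin n)) :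
    ∑ u ∈ F.dsc v, F.hLv (F.th v σ) u = ∑ u ∈ F.dsc v, F.hLv σ u + F.hLv σ v - F.invv σ v := by
  let l : Fin n → ℤ := fun x => if σ x < σ v then 1 else 0
  have h1 : ∀ u ∈ F.dsc v, F.hLv (F.th v σ) u = F.hLv σ u + l u * F.h u - l u -
      ∑ c ∈ F.kids (some u), l c * F.h c := by
    intro u hu
    have h2 : ∀ c ∈ F.kids (some u), (if F.th v σ c < F.th v σ u then 1 else 0) * (F.h c : ℤ) =
        (if σ c < σ u then 1 else 0) * (F.h c : ℤ) + l u * F.h c - l c * F.h c := by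
      intro c hc
      rw [mem_kids] at hc
      have hcv : c ∈ F.dsc v := F.dsc_trans (F.kid_mem_dsc hc) hu
      have h3 := rot_lt ((F.dsc v).image σ) (σ v) (Finset.mem_image_of_mem σ hu)
        (Finset.mem_image_of_mem σ hcv)
      have h4 : ((if F.th v σ c < F.th v σ u then 1 else 0) : ℤ) =
          (if σ c < σ u then 1 else 0) + l u - l c := h3
      rw [h4]
      ring
    rw [hLv, Finset.sum_congr rfl h2, Finset.sum_sub_distrib, Finset.sum_add_distrib,
      ← Finset.mul_sum, F.h_rec u, hLv]
    push_cast
    ring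
  rw [Finset.sum_congr rfl h1]
  simp only [Finset.sum_sub_distrib, Finset.sum_add_distrib]
  have h3 := F.sum_dsc v (fun c => l c * F.h c)
  have h4 : F.invv σ v = ∑ u ∈ F.dsc v, l u := rfl
  have h5 : F.hLv σ v = ∑ c ∈ F.kids (some v), l c * F.h c := rfl
  rw [h3, h4, h5]
  ring

/-- hybrid statistic -/
noncomputable def hyb (F : RootedForest (Fin n)) (A : Finset (Fin n)) (σ : Equiv.Perm (Fin n)) :
    ℤ := ∑ u, if u ∈ A then F.invv σ u else F.hLv σ u

lemma hyb_th (F : RootedForest (Fin n)) (A : Finset (Fin n)) (v : Fin n) (hv : v ∉ A)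
    (hA : ∀ u ∈ F.dsc v, u ∉ A) (σ : Equiv.Perm (Fin n)) :
    F.hyb (insert v A) (F.th v σ) = F.hyb A σ := by
  rw [← sub_eq_zero, hyb, hyb, ← Finset.sum_sub_distrib,
    ← Finset.sum_subset (Finset.subset_univ (insert v (F.dsc v)))]
  · rw [Finset.sum_insert (F.not_mem_dsc_self v)]
    have h1 : ∀ u ∈ F.dsc v, ((if u ∈ insert v A then F.invv (F.th v σ) u
        else F.hLv (F.th v σ) u) - if u ∈ A then F.invv σ u else F.hLv σ u) =
        F.hLv (F.th v σ) u - F.hLv σ u := by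
      intro u hu
      have h2 : u ≠ v := by rintro rfl; exact F.not_mem_dsc_self _ hu
      simp [hA u hu, h2]
    rw [Finset.sum_congr rfl h1, Finset.sum_sub_distrib, hLv_th_key]
    simp only [Finset.mem_insert, true_or, if_true, hv, if_false]
    rw [F.invv_th v v σ (F.not_mem_dsc_self v)]
    ring
  · intro u _ hu
    rw [Finset.mem_insert] at hu
    push Not at hu
    simp only [Finset.mem_insert, hu.1, false_or]
    rw [F.invv_th v u σ hu.2, F.hLv_th v u σ hu.2 hu.1, sub_self]

lemma h_lt_of_dsc (F : RootedForest (Fin n)) {c p : Fin n} (hc : c ∈ F.dsc p) : F.h c < F.h p := by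
  have h1 := Finset.card_lt_card (s := F.dsc c) (t := F.dsc p) (by
    rw [Finset.ssubset_iff_of_subset (F.dsc_subset hc)]
    exact ⟨c, hc, F.not_mem_dsc_self c⟩)
  rw [h_eq_card, h_eq_card]
  omega

lemma exists_hyb (F : RootedForest (Fin n)) (k : ℕ) (hk : k ≤ n) :
    ∃ A : Finset (Fin n), A.card = k ∧ (∀ v ∈ A, ∀ u, v ∈ F.dsc u → u ∈ A) ∧
      ∃ T : Equiv.Perm (Fin n) → Equiv.Perm (Fin n), Function.Injective T ∧
        ∀ σ, F.hyb A (T σ) = F.hyb ∅ σ := by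
  induction k with
  | zero => exact ⟨∅, rfl, by simp, id, Function.injective_id, fun _ => rfl⟩
  | succ k ih =>
    obtain ⟨A, hcard, hcl, T, hT, hyp⟩ := ih (by omega)
    have hne : (Finset.univ \ A).Nonempty := by
      rw [← Finset.card_pos, Finset.card_sdiff_of_subset (Finset.subset_univ A)]
      simp
      omega
    obtain ⟨v, hv, hmax⟩ := Finset.exists_max_image _ F.h hne
    have hvA : v ∉ A := by simpa using hv
    refine ⟨insert v A, ?_, ?_, F.th v ∘ T, (F.th_injective v).comp hT, ?_⟩
    · rw [Finset.card_insert_of_notMem hvA, hcard]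
    · intro w hw u hu
      rw [Finset.mem_insert] at hw ⊢
      right
      rcases hw with rfl | hw
      · by_contra hc
        have h1 := hmax u (by simpa using hc)
        have h2 := F.h_lt_of_dsc hu
        omega
      · exact hcl w hw u hu
    · intro σ
      rw [Function.comp, hyb_th F A v hvA, hyp]
      intro u hu huA
      exact hvA (hcl u huA v hu)

lemma exists_theta (F : RootedForest (Fin n)) :
    ∃ T : Equiv.Perm (Fin n) ≃ Equiv.Perm (Fin n),
      ∀ σ, ∑ v, F.invv (T σ) v = ∑ v, F.hLv σ v := by
  obtain ⟨A, hcard, _, T, hT, hyp⟩ := F.exists_hyb n le_rfl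
  have hA : A = Finset.univ := by
    rw [← Finset.card_eq_iff_eq_univ, hcard]; simp
  subst hA
  refine ⟨Equiv.ofBijective T (Finite.injective_iff_bijective.1 hT), fun σ => ?_⟩
  simpa [hyb] using hyp σ

/-- renaming of labels of a forest -/
def movF (σ : Equiv.Perm (Fin n)) (F : RootedForest (Fin n)) : RootedForest (Fin n) where
  parent x := (F.parent (σ.symm x)).map σ
  acyclic := by
    intro v hv
    apply F.acyclic (σ.symm v)
    refine Relation.TransGen.lift σ.symm ?_ _ _ hv
    intro a b hab
    rw [Option.map_eq_some_iff] at hab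
    obtain ⟨c, h1, rfl⟩ := hab
    simpa [Function.onFun] using h1

lemma movF_parent (σ : Equiv.Perm (Fin n)) (F : RootedForest (Fin n)) (x : Fin n) :
    (movF σ F).parent (σ x) = (F.parent x).map σ := by simp [movF]

lemma ext' {F G : RootedForest (Fin n)} (h : F.parent = G.parent) : F = G := by
  cases F; cases G; simpa using h

lemma movF_symm (σ : Equiv.Perm (Fin n)) (F : RootedForest (Fin n)) :
    movF σ.symm (movF σ F) = F := by
  apply ext'
  funext x
  simp [movF, Option.map_map]

lemma movF_symm' (σ : Equiv.Perm (Fin n)) (F : RootedForest (Fin n)) :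
    movF σ (movF σ.symm F) = F := by
  apply ext'
  funext x
  simp [movF, Option.map_map]

lemma movF_dsc (σ : Equiv.Perm (Fin n)) (F : RootedForest (Fin n)) (v : Fin n) :
    (movF σ F).dsc (σ v) = (F.dsc v).image σ := by
  have h1 : ∀ (σ : Equiv.Perm (Fin n)) (F : RootedForest (Fin n)) (u v : Fin n), F.Desc v u →
      (movF σ F).Desc (σ v) (σ u) := by
    intro σ F u v h
    refine Relation.TransGen.lift σ ?_ _ _ h
    intro a b hab
    change (movF σ F).parent _ = _
    rw [movF_parent, hab]
    rfl
  ext x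
  rw [mem_dsc, Finset.mem_image]
  constructor
  · intro h
    have h2 := h1 σ.symm _ _ _ h
    rw [movF_symm, Equiv.symm_apply_apply] at h2
    exact ⟨σ.symm x, by rwa [mem_dsc], by simp⟩
  · rintro ⟨u, hu, rfl⟩
    rw [mem_dsc] at hu
    exact h1 σ F u v hu

lemma movF_h (σ : Equiv.Perm (Fin n)) (F : RootedForest (Fin n)) (v : Fin n) :
    (movF σ F).h (σ v) = F.h v := by
  rw [h_eq_card, h_eq_card, movF_dsc, Finset.card_image_of_injective _ σ.injective]

lemma movF_kids (σ : Equiv.Perm (Fin n)) (F : RootedForest (Fin n)) (v : Fin n) :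
    (movF σ F).kids (some (σ v)) = (F.kids (some v)).image σ := by
  ext x
  obtain ⟨y, rfl⟩ := σ.surjective x
  simp [mem_kids, movF_parent]

lemma inv_eq_sum (F : RootedForest (Fin n)) :
    (F.inv : ℤ) = ∑ v, ∑ u ∈ F.dsc v, if u < v then 1 else 0 := by
  classical
  have : {p : Fin n × Fin n | F.Desc p.1 p.2 ∧ p.2 < p.1} =
      ((Finset.univ.filter (fun p : Fin n × Fin n => F.Desc p.1 p.2 ∧ p.2 < p.1) :
        Finset (Fin n × Fin n)) : Set (Fin n × Fin n)) := by ext; simp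
  rw [inv, this, Set.ncard_coe_finset, Finset.card_filter, Fintype.sum_prod_type]
  push_cast
  apply Finset.sum_congr rfl
  intro v _
  rw [dsc, Finset.sum_filter]
  apply Finset.sum_congr rfl
  intro u _
  by_cases h1 : F.Desc v u <;> simp [h1]

lemma coinv_eq_sum (F : RootedForest (Fin n)) :
    (F.coinv : ℤ) = ∑ v, ∑ u ∈ F.dsc v, if v < u then 1 else 0 := by
  classical
  have : {p : Fin n × Fin n | F.Desc p.1 p.2 ∧ p.1 < p.2} =
      ((Finset.univ.filter (fun p : Fin n × Fin n => F.Desc p.1 p.2 ∧ p.1 < p.2) :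
        Finset (Fin n × Fin n)) : Set (Fin n × Fin n)) := by ext; simp
  rw [coinv, this, Set.ncard_coe_finset, Finset.card_filter, Fintype.sum_prod_type]
  push_cast
  apply Finset.sum_congr rfl
  intro v _
  rw [dsc, Finset.sum_filter]
  apply Finset.sum_congr rfl
  intro u _
  by_cases h1 : F.Desc v u <;> simp [h1]

lemma inv_add_coinv (F : RootedForest (Fin n)) :
    (F.inv : ℤ) + F.coinv = ∑ v, ((F.h v : ℤ) - 1) := by
  rw [inv_eq_sum, coinv_eq_sum, ← Finset.sum_add_distrib]
  apply Finset.sum_congr rfl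
  intro v _
  rw [← Finset.sum_add_distrib, h_eq_card]
  have : ∀ u ∈ F.dsc v, ((if u < v then 1 else 0) + (if v < u then 1 else 0) : ℤ) = 1 := by
    intro u hu
    have : u ≠ v := by rintro rfl; exact F.not_mem_dsc_self _ hu
    split_ifs <;> omega
  rw [Finset.sum_congr rfl this]
  simp

lemma maj_add_comaj (F : RootedForest (Fin n)) :
    (F.maj : ℤ) + F.comaj = ∑ v, ((F.h v : ℤ) - 1) := by
  rw [maj, comaj]
  push_cast
  rw [← Finset.sum_add_distrib]
  apply Finset.sum_congr rfl
  intro v _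
  rw [h_eq_LR]
  push_cast
  ring

lemma movF_sum_h (σ : Equiv.Perm (Fin n)) (F : RootedForest (Fin n)) :
    ∑ v, (((movF σ F).h v : ℤ) - 1) = ∑ v, ((F.h v : ℤ) - 1) := by
  rw [← Equiv.sum_comp σ]
  simp only [movF_h]

lemma movF_inv (σ : Equiv.Perm (Fin n)) (F : RootedForest (Fin n)) :
    ((movF σ F).inv : ℤ) = ∑ v, F.invv σ v := by
  rw [inv_eq_sum, ← Equiv.sum_comp σ]
  simp only [movF_dsc, invv_eq]

lemma movF_maj (σ : Equiv.Perm (Fin n)) (F : RootedForest (Fin n)) :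
    ((movF σ F).maj : ℤ) = ∑ v, F.hLv σ v := by
  rw [maj, ← Equiv.sum_comp σ]
  push_cast
  apply Finset.sum_congr rfl
  intro v _
  rw [hL_eq, movF_kids, Finset.sum_filter, Finset.sum_image (fun _ _ _ _ h => σ.injective h), hLv]
  push_cast
  apply Finset.sum_congr rfl
  intro c _
  rw [movF_h]
  split_ifs <;> simp

lemma exists_inv_equiv (n : ℕ) : ∃ e : RootedForest (Fin n) ≃ RootedForest (Fin n),
    ∀ F, (e F).inv = F.maj ∧ (e F).coinv = F.comaj := by
  have hfin : Finite (RootedForest (Fin n)) :=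
    Finite.of_injective (fun F : RootedForest (Fin n) => F.parent) (fun _ _ h => ext' h)
  choose T hT using exists_theta (n := n)
  let R : RootedForest (Fin n) × Equiv.Perm (Fin n) ≃ RootedForest (Fin n) × Equiv.Perm (Fin n) :=
    { toFun := fun x => (movF x.2 x.1, x.2)
      invFun := fun x => (movF x.2.symm x.1, x.2)
      left_inv := fun x => by simp [movF_symm]
      right_inv := fun x => by simp [movF_symm'] }
  let Θ : RootedForest (Fin n) × Equiv.Perm (Fin n) ≃ RootedForest (Fin n) × Equiv.Perm (Fin n) :=
    { toFun := fun x => (x.1, T x.1 x.2)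
      invFun := fun x => (x.1, (T x.1).symm x.2)
      left_inv := fun x => by simp
      right_inv := fun x => by simp }
  let I : RootedForest (Fin n) → ℕ × ℕ := fun F => (F.inv, F.coinv)
  let M : RootedForest (Fin n) → ℕ × ℕ := fun F => (F.maj, F.comaj)
  have h1 : ∀ x, I (R (Θ x)).1 = M (R x).1 := by
    rintro ⟨F, σ⟩
    have e1 : ((movF (T F σ) F).inv : ℤ) = (movF σ F).maj := by
      rw [movF_inv, movF_maj, hT]
    have e2 := (movF (T F σ) F).inv_add_coinv
    have e3 := (movF σ F).maj_add_comaj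
    rw [movF_sum_h] at e2 e3
    simp only [I, M, R, Θ, Equiv.coe_fn_mk, Prod.mk.injEq]
    omega
  have h2 : ∀ x, I ((R.symm.trans (Θ.trans R)) x).1 = M x.1 := by
    intro x
    have := h1 (R.symm x)
    simpa using this
  have h3 : ∀ p, Nat.card {F // M F = p} = Nat.card {F // I F = p} := by
    intro p
    have e1 := Nat.card_congr (Equiv.prodSubtypeFstEquivSubtypeProd
      (p := fun F => M F = p) (β := Equiv.Perm (Fin n)))
    have e2 := Nat.card_congr (Equiv.prodSubtypeFstEquivSubtypeProd
      (p := fun F => I F = p) (β := Equiv.Perm (Fin n)))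
    have e3 := Nat.card_congr ((R.symm.trans (Θ.trans R)).subtypeEquiv
      (p := fun x => M x.1 = p) (q := fun x => I x.1 = p) (fun x => by rw [h2]))
    rw [e1, e2, Nat.card_prod, Nat.card_prod] at e3
    exact Nat.eq_of_mul_eq_mul_right Nat.card_pos e3
  have h4 : ∀ p, Nonempty ({F // M F = p} ≃ {F // I F = p}) := fun p =>
    Finite.card_eq.1 (h3 p)
  let E := fun p => Classical.choice (h4 p)
  let e := (Equiv.sigmaFiberEquiv M).symm.trans
    ((Equiv.sigmaCongrRight E).trans (Equiv.sigmaFiberEquiv I))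
  refine ⟨e, fun F => ?_⟩
  have h5 : I (e F) = M F := (E (M F) ⟨F, rfl⟩).2
  exact ⟨congrArg Prod.fst h5, congrArg Prod.snd h5⟩

end RootedForest

/-- For every `n ≥ 1`, the bi-statistics `(inv, coinv)` on rooted forests
`R_n` and `(area, coarea)` on minimal factorizations `F_n` have the same joint
distribution: there is a bijection `ψ : F_n → R_n` with `inv (ψ f) = area f` and
`coinv (ψ f) = coarea f` for all `f`. -/
theorem stmt0 (n : ℕ) (hn : 1 ≤ n) :
    ∃ ψ : MinFact n ≃ RootedForest (Fin n),
      ∀ f : MinFact n,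
        ((ψ f).inv : ℤ) = MinFact.area f ∧ ((ψ f).coinv : ℤ) = MinFact.coarea f := by
  obtain ⟨e, he⟩ := exists_maj_equiv n
  obtain ⟨e', he'⟩ := RootedForest.exists_inv_equiv n
  refine ⟨e.trans e', fun f => ?_⟩
  rw [Equiv.trans_apply, (he' _).1, (he' _).2]
  exact he f
end

section
/- For all n, k ≥ 1, there exists a bijection φ: F_n^k → R_n^k such that, writing F = φ(f) for f = (τ_1,…,τ_n) ∈ F_n^k with τ_j = (a_j^0 a_j^1 ⋯ a_j^k): area_k(f) = k·maj_k(F), coarea_k(f) = k·comaj_k(F), semiarea_k(f) = k·maj(F), cosemiarea_k(f) = k·comaj(F), and moreover a_j^k − a_j^0 = k·h(j) for every j ∈ {1,…,n}, where h(j) is the hook length at vertex j in F. -/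
namespace KFact

open Finset

variable {n k : ℕ}

/-! ### Forest facts -/

section Forest

variable (F : RootedForest (Fin n))

abbrev PR (a b : Fin n) : Prop := F.parent a = some b

lemma hook_eq (u : Fin n) : F.hook u = {v | Relation.ReflTransGen (PR F) v u} := by
  ext v
  simp only [RootedForest.hook, RootedForest.Desc, Set.mem_ofPred_eq]
  rw [Relation.reflTransGen_iff_eq_or_transGen]
  constructor
  · rintro (h | h)
    · exact Or.inl h.symm
    · exact Or.inr h
  · rintro (h | h)
    · exact Or.inl h.symm
    · exact Or.inr h

open Classical in
lemma h_eq (u : Fin n) :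
    F.h u = (univ.filter (fun v => Relation.ReflTransGen (PR F) v u)).card := by
  rw [RootedForest.h, hook_eq, ← Set.ncard_coe_finset]
  congr 1
  ext v
  simp

lemma h_pos (u : Fin n) : 1 ≤ F.h u := by
  classical
  rw [h_eq]
  apply Finset.card_pos.mpr
  exact ⟨u, by simp [Relation.ReflTransGen.refl]⟩

lemma h_le (u : Fin n) : F.h u ≤ n := by
  classical
  rw [h_eq]
  exact (Finset.card_le_univ _).trans (by simp)

lemma hook_disj (o : Option (Fin n)) (c d v : Fin n) (hc : F.parent c = o) (hd : F.parent d = o)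
    (h1 : Relation.ReflTransGen (PR F) v c) (h2 : Relation.ReflTransGen (PR F) v d) : c = d := by
  have key : ∀ c d : Fin n, F.parent c = o → F.parent d = o →
      Relation.ReflTransGen (PR F) c d → c = d := by
    intro c d hc hd h
    rcases Relation.ReflTransGen.cases_head h with h | ⟨e, he, h⟩
    · exact h
    · exfalso
      have he' : F.parent c = some e := he
      have : F.parent d = some e := by rw [hd, ← hc, he']
      exact F.acyclic e (Relation.TransGen.tail' h this)
  have ru : Relator.RightUnique (PR F) := by
    intro a b c h1 h2
    have h1' : F.parent a = some b := h1
    have h2' : F.parent a = some c := h2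
    rw [h1'] at h2'
    exact Option.some.inj h2'
  rcases Relation.ReflTransGen.total_of_right_unique ru h1 h2 with h | h
  · exact key _ _ hc hd h
  · exact (key _ _ hd hc h).symm

open Classical in
lemma sum_children (o : Option (Fin n)) :
    ∑ v ∈ univ.filter (fun v => F.parent v = o), F.h v =
      (univ.filter (fun v => ∃ c, F.parent c = o ∧ Relation.ReflTransGen (PR F) v c)).card := by
  simp only [h_eq]
  rw [← Finset.card_biUnion]
  · congr 1
    ext v
    simp
  · intro c hc d hd hne
    simp only [coe_filter, mem_univ, true_and, Set.mem_ofPred_eq] at hc hd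
    rw [Function.onFun, Finset.disjoint_left]
    intro v h1 h2
    simp only [mem_filter, mem_univ, true_and] at h1 h2
    exact hne (hook_disj F o c d v hc hd h1 h2)

lemma h_rec (u : Fin n) :
    F.h u = 1 + ∑ v ∈ univ.filter (fun v => F.parent v = some u), F.h v := by
  classical
  rw [sum_children, h_eq]
  have : (univ.filter (fun v => Relation.ReflTransGen (PR F) v u)) =
      insert u (univ.filter (fun v => ∃ c, F.parent c = some u ∧
        Relation.ReflTransGen (PR F) v c)) := by
    ext v
    simp only [mem_filter, mem_univ, true_and, mem_insert]
    rw [Relation.ReflTransGen.cases_tail_iff]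
    constructor
    · rintro (h | ⟨c, h, hc⟩)
      · exact Or.inl h.symm
      · exact Or.inr ⟨c, hc, h⟩
    · rintro (h | ⟨c, h, hc⟩)
      · exact Or.inl h.symm
      · exact Or.inr ⟨c, hc, h⟩
  rw [this, Finset.card_insert_of_notMem, add_comm]
  simp only [mem_filter, mem_univ, true_and, not_exists, not_and]
  intro c hc h
  exact F.acyclic u (Relation.TransGen.tail' h hc)

lemma h_lt {u v : Fin n} (h : F.parent v = some u) : F.h v < F.h u := by
  rw [h_rec F u]
  have : F.h v ≤ ∑ v ∈ univ.filter (fun v => F.parent v = some u), F.h v :=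
    Finset.single_le_sum (f := fun v => F.h v) (fun _ _ => Nat.zero_le _) (by simp [h])
  omega

lemma exists_root (m : ℕ) : ∀ v : Fin n, n - F.h v = m →
    ∃ c, F.parent c = none ∧ Relation.ReflTransGen (PR F) v c := by
  induction m using Nat.strong_induction_on with
  | _ m ih =>
    intro v hv
    rcases hp : F.parent v with _ | u
    · exact ⟨v, hp, Relation.ReflTransGen.refl⟩
    · have h1 := h_lt F hp
      have h2 := h_le F u
      obtain ⟨c, hc, h⟩ := ih (n - F.h u) (by omega) u rfl
      exact ⟨c, hc, Relation.ReflTransGen.head hp h⟩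

lemma sum_roots : ∑ v ∈ univ.filter (fun v => F.parent v = none), F.h v = n := by
  classical
  rw [sum_children]
  have : (univ.filter (fun v => ∃ c, F.parent c = none ∧ Relation.ReflTransGen (PR F) v c))
      = univ := by
    ext v
    simpa using exists_root F _ v rfl
  rw [this]
  simp

end Forest

/-! ### Keys, partial sums, positions -/

def low (K : Fin n → Option (Fin n × Fin k)) (w : Fin n → ℤ) (c : Option (Fin n × Fin k))
    (t : ℕ) : ℤ :=
  ∑ v ∈ univ.filter (fun v => K v = c ∧ v.val < t), w v

lemma low_zero (K : Fin n → Option (Fin n × Fin k)) (w c) : low K w c 0 = 0 := by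
  simp [low]

lemma low_succ (K : Fin n → Option (Fin n × Fin k)) (w c) (t : Fin n) :
    low K w c (t.val + 1) = low K w c t.val + if K t = c then w t else 0 := by
  have h : (if K t = c then w t else 0) = ∑ v, if v = t then (if K v = c then w v else 0) else 0 := by
    simp
  rw [low, low, Finset.sum_filter, Finset.sum_filter, h, ← Finset.sum_add_distrib]
  apply Finset.sum_congr rfl
  intro v _
  by_cases h1 : v = t
  · subst h1
    simp
  · have h2 : v.val ≠ t.val := fun h => h1 (Fin.ext h)
    have h3 : v.val < t.val + 1 ↔ v.val < t.val := by omega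
    simp [h1, h3]

lemma low_mono (K : Fin n → Option (Fin n × Fin k)) (w c) (hw : ∀ v, 0 ≤ w v) {s t : ℕ}
    (h : s ≤ t) : low K w c s ≤ low K w c t := by
  unfold low
  apply Finset.sum_le_sum_of_subset_of_nonneg
  · intro v
    simp only [mem_filter, mem_univ, true_and]
    rintro ⟨h1, h2⟩
    exact ⟨h1, by omega⟩
  · intro v _ _
    exact hw v

lemma low_top (K : Fin n → Option (Fin n × Fin k)) (w c) :
    low K w c n = ∑ v ∈ univ.filter (fun v => K v = c), w v := by
  simp [low]

def jump (A : Fin n → Fin (k+1) → ℤ) (c : Option (Fin n × Fin k)) (t : ℕ) : ℤ :=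
  match c with
  | none => 0
  | some (j, i) => if j.val < t then A j i.succ - A j i.castSucc else 0

def start (K : Fin n → Option (Fin n × Fin k)) (w : Fin n → ℤ) (A : Fin n → Fin (k+1) → ℤ)
    (c : Option (Fin n × Fin k)) : ℤ :=
  match c with
  | none => (k : ℤ) * n
  | some (j, i) => A j i.castSucc + low K w (some (j, i)) j.val

def pos (K : Fin n → Option (Fin n × Fin k)) (w : Fin n → ℤ) (A : Fin n → Fin (k+1) → ℤ)
    (c : Option (Fin n × Fin k)) (t : ℕ) : ℤ :=
  start K w A c - low K w c t + jump A c t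

structure Rel (K : Fin n → Option (Fin n × Fin k)) (w : Fin n → ℤ)
    (A : Fin n → Fin (k+1) → ℤ) : Prop where
  hw : ∀ v, A v (Fin.last k) - A v 0 = w v
  hs : ∀ j i, A j i.succ - A j i.castSucc = 1 + low K w (some (j, i)) n
  hp : ∀ v, pos K w A (K v) v.val = A v (Fin.last k)

def key (F : KForest n k) (v : Fin n) : Option (Fin n × Fin k) :=
  (F.parent v).map (fun u => (u, ⟨k - 1 - F.colour v, by have := F.colour_lt v; omega⟩))

noncomputable def wt (F : KForest n k) (v : Fin n) : ℤ := (k : ℤ) * F.toRootedForest.h v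

lemma key_none {F : KForest n k} {v : Fin n} : key F v = none ↔ F.parent v = none := by
  simp [key]

lemma key_some {F : KForest n k} {v j : Fin n} {i : Fin k} (h : key F v = some (j, i)) :
    F.parent v = some j := by
  simp only [key, Option.map_eq_some_iff] at h
  obtain ⟨u, hu, h⟩ := h
  rw [hu, (Prod.mk.inj h).1]

lemma key_ne {F : KForest n k} {v : Fin n} {i : Fin k} : key F v ≠ some (v, i) := by
  intro h
  exact F.acyclic v (Relation.TransGen.single (key_some h))

lemma wt_nonneg (F : KForest n k) (v : Fin n) : 0 ≤ wt F v := by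
  unfold wt; positivity

lemma key_inj {F G : KForest n k} (h : key F = key G) : F = G := by
  have hp : F.parent = G.parent := by
    funext v
    have := congrFun h v
    rcases hF : F.parent v with _ | u
    · rw [key_none.mpr hF] at this
      exact (key_none.mp this.symm).symm
    · have h2 : key F v = some (u, ⟨k - 1 - F.colour v, by have := F.colour_lt v; omega⟩) := by
        simp [key, hF]
      rw [this] at h2
      exact (key_some h2).symm
  have hc : F.colour = G.colour := by
    funext v
    have h0 := congrFun h v
    rcases hF : F.parent v with _ | u
    · rw [F.colour_root v hF, G.colour_root v (by rw [← hp, hF])]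
    · have hG : G.parent v = some u := by rw [← hp, hF]
      simp [key, hF, hG] at h0
      have := F.colour_lt v
      have := G.colour_lt v
      omega
  obtain ⟨⟨p, _⟩, c, _, _⟩ := F
  obtain ⟨⟨p', _⟩, c', _, _⟩ := G
  simp only at hp hc
  subst hp hc
  rfl

lemma exists_forest (hk : 1 ≤ k) (K : Fin n → Option (Fin n × Fin k)) (m : Fin n → ℤ)
    (hm : ∀ v j i, K v = some (j, i) → m v < m j) : ∃ F : KForest n k, key F = K := by
  have hmm : ∀ a b, Relation.TransGen (fun a b : Fin n => (K a).map Prod.fst = some b) a b →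
      m a < m b := by
    intro a b h
    induction h with
    | single h =>
      simp only [Option.map_eq_some_iff] at h
      obtain ⟨⟨j, i⟩, h, rfl⟩ := h
      exact hm _ _ _ h
    | tail _ h ih =>
      simp only [Option.map_eq_some_iff] at h
      obtain ⟨⟨j, i⟩, h, rfl⟩ := h
      exact ih.trans (hm _ _ _ h)
  refine ⟨⟨⟨fun v => (K v).map Prod.fst, ?_⟩,
    fun v => match K v with | none => 0 | some (j, i) => k - 1 - i.val, ?_, ?_⟩, ?_⟩
  · intro v h
    exact absurd (hmm _ _ h) (lt_irrefl _)
  · intro v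
    rcases K v with _ | ⟨j, i⟩
    · simp; omega
    · simp; omega
  · intro v h
    simp only [Option.map_eq_none_iff] at h
    simp [h]
  · funext v
    rcases h : K v with _ | ⟨j, i⟩
    · simp [key, h]
    · simp [key, h]
      ext
      simp
      omega

end KFact
namespace KFact

open Finset

variable {n k : ℕ}

lemma jump_succ_ne (A : Fin n → Fin (k+1) → ℤ) (c : Option (Fin n × Fin k)) (t : Fin n)
    (h : ∀ i, c ≠ some (t, i)) : jump A c (t.val + 1) = jump A c t.val := by
  rcases c with _ | ⟨j, i⟩
  · rfl
  · have h1 : j ≠ t := by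
      rintro rfl
      exact h i rfl
    have h2 : j.val ≠ t.val := fun h => h1 (Fin.ext h)
    have h3 : j.val < t.val + 1 ↔ j.val < t.val := by omega
    simp [jump, h3]

section Generic

variable (K : Fin n → Option (Fin n × Fin k)) (w : Fin n → ℤ) (A : Fin n → Fin (k+1) → ℤ)

lemma pos_succ_key (t : Fin n) (h : ∀ i, K t ≠ some (t, i)) :
    pos K w A (K t) (t.val + 1) = pos K w A (K t) t.val - w t := by
  rw [pos, pos, low_succ, jump_succ_ne _ _ _ h]
  simp only [if_true]
  ring

lemma pos_succ_self (t : Fin n) (i : Fin k) (h : K t ≠ some (t, i)) :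
    pos K w A (some (t, i)) (t.val + 1) =
      pos K w A (some (t, i)) t.val + (A t i.succ - A t i.castSucc) := by
  rw [pos, pos, low_succ]
  simp [h, jump]

lemma pos_succ_other (t : Fin n) (c : Option (Fin n × Fin k)) (h : K t ≠ c)
    (h' : ∀ i, c ≠ some (t, i)) :
    pos K w A c (t.val + 1) = pos K w A c t.val := by
  rw [pos, pos, low_succ, jump_succ_ne _ _ _ h']
  simp [h]

lemma pos_self (j : Fin n) (i : Fin k) : pos K w A (some (j, i)) j.val = A j i.castSucc := by
  simp [pos, start, jump]

lemma pos_self_succ (j : Fin n) (i : Fin k) (h : K j ≠ some (j, i)) :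
    pos K w A (some (j, i)) (j.val + 1) = A j i.succ := by
  rw [pos_succ_self K w A j i h, pos_self]
  ring

lemma pos_zero (c : Option (Fin n × Fin k)) : pos K w A c 0 = start K w A c := by
  rw [pos, low_zero]
  rcases c with _ | ⟨j, i⟩ <;> simp [jump]

/-- positions weakly decrease away from the jump -/
lemma pos_anti (hw : ∀ v, 0 ≤ w v) (c : Option (Fin n × Fin k)) {s t : ℕ} (h : s ≤ t)
    (hj : jump A c s = jump A c t) : pos K w A c t ≤ pos K w A c s := by
  have := low_mono K w c hw h
  rw [pos, pos, hj]
  linarith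

end Generic

lemma discrete (g : ℕ → ℤ) (x : ℤ) (s e : ℕ) (h : s ≤ e) (h1 : g e ≤ x) (h2 : x < g s) :
    ∃ t, s ≤ t ∧ t < e ∧ g (t + 1) ≤ x ∧ x < g t := by
  induction e, h using Nat.le_induction with
  | base => omega
  | succ e he ih =>
    by_cases h3 : g e ≤ x
    · obtain ⟨t, h4, h5, h6⟩ := ih h3
      exact ⟨t, h4, by omega, h6⟩
    · exact ⟨e, he, by omega, h1, by omega⟩

lemma discreteFin (g : Fin (k+1) → ℤ) (x : ℤ) (h1 : g 0 ≤ x) (h2 : x < g (Fin.last k)) :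
    ∃ i : Fin k, g i.castSucc ≤ x ∧ x < g i.succ := by
  by_contra hcon
  push Not at hcon
  have : ∀ i : Fin (k+1), g i ≤ x := by
    intro i
    induction i using Fin.induction with
    | zero => exact h1
    | succ i ih => exact hcon i ih
  have := this (Fin.last k)
  omega

section ForestRel

variable {F : KForest n k} {A : Fin n → Fin (k+1) → ℤ}

lemma low_none_top (F : KForest n k) : low (key F) (wt F) none n = (k : ℤ) * n := by
  rw [low_top]
  have := sum_roots F.toRootedForest
  simp only [key_none, wt]
  rw [← Finset.mul_sum]
  congr 1
  exact_mod_cast this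

lemma pos_none_top (F : KForest n k) (A : Fin n → Fin (k+1) → ℤ) :
    pos (key F) (wt F) A none n = 0 := by
  rw [pos, low_none_top]
  simp [start, jump]


lemma pos_some_top
    (H : Rel (key F) (wt F) A)
    (j : Fin n) (i : Fin k) :
    pos (key F) (wt F) A (some (j, i)) n = start (key F) (wt F) A (some (j, i)) + 1 := by
  rw [pos]
  simp only [jump, j.2, if_true, H.hs]
  ring

lemma pos_key
    (H : Rel (key F) (wt F) A)
    (v : Fin n) : pos (key F) (wt F) A (key F v) (v.val + 1) = A v 0 := by
  rw [pos_succ_key _ _ _ _ (fun i => key_ne), H.hp, ← H.hw v]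
  ring

lemma step_pos
    (H : Rel (key F) (wt F) A)
    (j : Fin n) (i : Fin k) : 1 ≤ A j i.succ - A j i.castSucc := by
  rw [H.hs]
  have := low_mono (key F) (wt F) (some (j, i)) (wt_nonneg F) (Nat.zero_le n)
  rw [low_zero] at this
  linarith

/-- a drop strictly containing `x` comes from a vertex -/
lemma drop
    (H : Rel (key F) (wt F) A)
    (c : Option (Fin n × Fin k)) (x : ℤ) (t : ℕ) (ht : t < n)
    (hc : ∀ i, c ≠ some (⟨t, ht⟩, i))
    (h1 : pos (key F) (wt F) A c (t + 1) ≤ x) (h2 : x < pos (key F) (wt F) A c t) :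
    ∃ v, key F v = c ∧ A v 0 ≤ x ∧ x < A v (Fin.last k) := by
  by_cases h : key F ⟨t, ht⟩ = c
  · subst h
    refine ⟨⟨t, ht⟩, rfl, ?_, ?_⟩
    · rw [← pos_key H]; exact h1
    · rw [← H.hp]; exact h2
  · have := pos_succ_other (key F) (wt F) A ⟨t, ht⟩ c h hc
    simp only at this
    omega

lemma cover
    (H : Rel (key F) (wt F) A)
    (m : ℕ) : ∀ v : Fin n, F.toRootedForest.h v = m → ∀ x, A v 0 ≤ x →
    x < A v (Fin.last k) → ∃ j i, start (key F) (wt F) A (some (j, i)) = x := by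
  induction m using Nat.strong_induction_on with
  | _ m ih =>
    intro v hv x h1 h2
    obtain ⟨i, h3, h4⟩ := discreteFin (A v) x h1 h2
    have child : ∀ u, key F u = some (v, i) ∧ A u 0 ≤ x ∧ x < A u (Fin.last k) →
        ∃ j i, start (key F) (wt F) A (some (j, i)) = x := by
      rintro u ⟨hu, h5, h6⟩
      have := h_lt F.toRootedForest (key_some hu)
      exact ih _ (by omega) u rfl x h5 h6
    rcases lt_trichotomy x (start (key F) (wt F) A (some (v, i))) with h | h | h
    · obtain ⟨t, h5, h6, h7, h8⟩ := discrete (pos (key F) (wt F) A (some (v, i))) x 0 v.val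
        (Nat.zero_le _) (by rw [pos_self]; exact h3) (by rw [pos_zero]; exact h)
      obtain ⟨u, hu⟩ := drop H (some (v, i)) x t (by omega) (by
        intro i' h'
        have := congrArg Fin.val (Prod.mk.inj (Option.some.inj h')).1
        simp at this
        omega) h7 h8
      exact child u hu
    · exact ⟨v, i, h.symm⟩
    · obtain ⟨t, h5, h6, h7, h8⟩ := discrete (pos (key F) (wt F) A (some (v, i))) x (v.val + 1) n
        (by omega) (by rw [pos_some_top H]; omega)
        (by rw [pos_self_succ _ _ _ _ _ key_ne]; exact h4)
      obtain ⟨u, hu⟩ := drop H (some (v, i)) x t (by omega) (by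
        intro i' h'
        have := congrArg Fin.val (Prod.mk.inj (Option.some.inj h')).1
        simp at this
        omega) h7 h8
      exact child u hu

lemma cover_all
    (H : Rel (key F) (wt F) A)
    (x : ℤ) (h0 : 0 ≤ x) (h1 : x < (k : ℤ) * n) :
    ∃ p : Fin n × Fin k, start (key F) (wt F) A (some p) = x := by
  obtain ⟨t, h5, h6, h7, h8⟩ := discrete (pos (key F) (wt F) A none) x 0 n
    (Nat.zero_le _) (by rw [pos_none_top]; exact h0) (by rw [pos_zero]; exact h1)
  obtain ⟨u, _, h2, h3⟩ := drop H none x t h6 (by simp) h7 h8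
  obtain ⟨j, i, h⟩ := cover H _ u rfl x h2 h3
  exact ⟨(j, i), h⟩

lemma image_start
    (H : Rel (key F) (wt F) A)
    : (univ : Finset (Fin n × Fin k)).image
      (fun p => start (key F) (wt F) A (some p)) = Finset.Ico (0 : ℤ) ((k : ℤ) * n) ∧
    Function.Injective (fun p : Fin n × Fin k => start (key F) (wt F) A (some p)) := by
  have hsub : Finset.Ico (0 : ℤ) ((k : ℤ) * n) ⊆ (univ : Finset (Fin n × Fin k)).image
      (fun p => start (key F) (wt F) A (some p)) := by
    intro x hx
    rw [Finset.mem_Ico] at hx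
    obtain ⟨p, hp⟩ := cover_all H x hx.1 hx.2
    exact Finset.mem_image.mpr ⟨p, mem_univ _, hp⟩
  have hcI : (Finset.Ico (0 : ℤ) ((k : ℤ) * n)).card = n * k := by
    rw [Int.card_Ico]
    simp only [sub_zero]
    rw [← Nat.cast_mul, Int.toNat_natCast, mul_comm]
  have hcu : (univ : Finset (Fin n × Fin k)).card = n * k := by simp
  have hle := Finset.card_image_le (s := (univ : Finset (Fin n × Fin k)))
    (f := fun p => start (key F) (wt F) A (some p))
  have heq := Finset.eq_of_subset_of_card_le hsub (by omega)
  refine ⟨heq.symm, ?_⟩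
  have : Set.InjOn (fun p : Fin n × Fin k => start (key F) (wt F) A (some p))
      (univ : Finset (Fin n × Fin k)) := by
    apply Finset.card_image_iff.mp
    rw [← heq, hcI, hcu]
  intro p q hpq
  exact this (by simp) (by simp) hpq

lemma start_range
    (H : Rel (key F) (wt F) A)
    (p : Fin n × Fin k) : 0 ≤ start (key F) (wt F) A (some p) ∧
    start (key F) (wt F) A (some p) < (k : ℤ) * n := by
  have : start (key F) (wt F) A (some p) ∈ Finset.Ico (0 : ℤ) ((k : ℤ) * n) := by
    rw [← (image_start H).1]
    exact Finset.mem_image.mpr ⟨p, mem_univ _, rfl⟩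
  simpa using this

lemma start_inj
    (H : Rel (key F) (wt F) A)
    : Function.Injective (start (key F) (wt F) A) := by
  intro c d h
  rcases c with _ | p <;> rcases d with _ | q
  · rfl
  · have := (start_range H q).2
    rw [← h] at this
    simp [start] at this
  · have := (start_range H p).2
    rw [h] at this
    simp [start] at this
  · rw [(image_start H).2 h]

lemma sum_start
    (H : Rel (key F) (wt F) A)
    : ∑ p : Fin n × Fin k, start (key F) (wt F) A (some p) = ((k*n).choose 2 : ℤ) := by
  have h1 := Finset.sum_image (s := (univ : Finset (Fin n × Fin k))) (f := fun x : ℤ => x)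
    (g := fun p => start (key F) (wt F) A (some p)) ((image_start H).2.injOn)
  rw [← h1, (image_start H).1]
  have h2 : ∀ m : ℕ, ∑ x ∈ Finset.Ico (0 : ℤ) (m : ℤ), x = (m.choose 2 : ℤ) := by
    intro m
    have : Finset.Ico (0 : ℤ) (m : ℤ) = (Finset.range m).image (fun x : ℕ => (x : ℤ)) := by
      ext x
      simp only [mem_Ico, mem_image, mem_range]
      constructor
      · rintro ⟨h, h'⟩
        exact ⟨x.toNat, by omega, by omega⟩
      · rintro ⟨y, h, rfl⟩
        omega
    rw [this, Finset.sum_image (by intro a _ b _ h; simpa using h)]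
    rw [← Nat.cast_sum, Finset.sum_range_id, Nat.choose_two_right]
  have := h2 (k * n)
  push_cast at this
  exact this

end ForestRel

end KFact
namespace KFact

open Finset

variable {n k : ℕ}

section Perm

def tau {N : ℕ} (a : Fin n → Fin (k+1) → Fin N) (j : Fin n) : Equiv.Perm (Fin N) :=
  (List.ofFn (a j)).formPerm

def prodT {N : ℕ} (a : Fin n → Fin (k+1) → Fin N) (t : ℕ) : Equiv.Perm (Fin N) :=
  ((List.ofFn (tau a)).take t).reverse.prod

variable {N : ℕ} (a : Fin n → Fin (k+1) → Fin N)

lemma prodT_zero : prodT a 0 = 1 := by simp [prodT]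

lemma prodT_succ (t : Fin n) : prodT a (t.val + 1) = tau a t * prodT a t.val := by
  have : (List.ofFn (tau a)).take (t.val + 1) = (List.ofFn (tau a)).take t.val ++ [tau a t] := by
    rw [List.take_succ_eq_append_getElem (by simp)]
    simp
  rw [prodT, this, prodT]
  simp

lemma prodT_top : prodT a n = (List.ofFn (fun j => (List.ofFn (a j)).formPerm)).reverse.prod := by
  rw [prodT, List.take_of_length_le (by simp)]
  rfl

lemma tau_step (j : Fin n) (h : Function.Injective (a j)) (i : Fin k) :
    tau a j (a j i.castSucc) = a j i.succ := by
  have hn : (List.ofFn (a j)).Nodup := List.nodup_ofFn.mpr h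
  have := List.formPerm_apply_lt_getElem (List.ofFn (a j)) hn i.val (by simp)
  simp only [List.getElem_ofFn] at this
  exact this

lemma tau_last (j : Fin n) : tau a j (a j (Fin.last k)) = a j 0 := by
  have := List.formPerm_apply_getElem_length (a j 0) (List.ofFn (fun i : Fin k => a j i.succ))
  unfold tau
  rw [List.ofFn_succ]
  convert this using 2
  rcases k with _ | k
  · simp
  · simp only [List.length_ofFn, List.getElem_cons_succ, List.getElem_ofFn]
    rfl

lemma tau_other (j : Fin n) (y : Fin N) (h : ∀ i, y ≠ a j i) : tau a j y = y := by
  apply List.formPerm_apply_of_notMem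
  simp only [List.mem_ofFn, not_exists]
  intro i hi
  exact h i hi.symm

end Perm

def AZ (a : Fin n → Fin (k+1) → Fin (k*n+1)) (j : Fin n) (i : Fin (k+1)) : ℤ := ((a j i : ℕ) : ℤ)

section Traj

variable {F : KForest n k} {a : Fin n → Fin (k+1) → Fin (k*n+1)}


lemma start_fin
    (H : Rel (key F) (wt F) (AZ a))
    (c : Option (Fin n × Fin k)) :
    ∃ x : Fin (k*n+1), ((x : ℕ) : ℤ) = start (key F) (wt F) (AZ a) c := by
  rcases c with _ | p
  · exact ⟨Fin.last _, by simp [start]⟩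
  · obtain ⟨h1, h2⟩ := start_range H p
    have h3 : (start (key F) (wt F) (AZ a) (some p)).toNat < k * n + 1 := by
      zify
      rw [Int.toNat_of_nonneg h1]
      linarith
    exact ⟨⟨_, h3⟩, by simp [h1]⟩


lemma traj
    (hinj : ∀ j, Function.Injective (a j)) (H : Rel (key F) (wt F) (AZ a))
    (t : ℕ) (ht : t ≤ n) : ∀ (c : Option (Fin n × Fin k)) (x : Fin (k*n+1)),
    ((x : ℕ) : ℤ) = start (key F) (wt F) (AZ a) c →
    ((prodT a t x : ℕ) : ℤ) = pos (key F) (wt F) (AZ a) c t := by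
  induction t with
  | zero =>
    intro c x hx
    rw [prodT_zero, pos_zero, ← hx]
    rfl
  | succ t ih =>
    intro c x hx
    have ih' := ih (by omega)
    obtain ⟨T, rfl⟩ : ∃ T : Fin n, T.val = t := ⟨⟨t, by omega⟩, rfl⟩
    rw [prodT_succ a T, Equiv.Perm.mul_apply]
    have uniq : ∀ c', pos (key F) (wt F) (AZ a) c' T.val = ((prodT a T.val x : ℕ) : ℤ) → c = c' := by
      intro c' h'
      obtain ⟨x', hx'⟩ := start_fin H c'
      have h1 := ih' c' x' hx'
      have h2 : prodT a T.val x' = prodT a T.val x := by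
        apply Fin.ext
        have := h1.trans h'
        exact_mod_cast this
      have h3 := (prodT a T.val).injective h2
      subst h3
      exact start_inj H (hx.symm.trans hx')
    have hkey := H.hp T
    have hy := ih' c x hx
    by_cases hc1 : key F T = c
    · subst hc1
      have h1 : prodT a T.val x = a T (Fin.last k) := by
        apply Fin.ext
        have := hy.trans hkey
        simp only [AZ] at this
        exact_mod_cast this
      rw [h1, tau_last]
      exact (pos_key H T).symm
    · by_cases hc2 : ∃ i, c = some (T, i)
      · obtain ⟨i, rfl⟩ := hc2
        have h1 : prodT a T.val x = a T i.castSucc := by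
          apply Fin.ext
          have := hy.trans (pos_self (key F) (wt F) (AZ a) T i)
          simp only [AZ] at this
          exact_mod_cast this
        rw [h1, tau_step a T (hinj T)]
        exact (pos_self_succ (key F) (wt F) (AZ a) T i hc1).symm
      · push Not at hc2
        have h0 := pos_succ_other (key F) (wt F) (AZ a) T c hc1 hc2
        rw [tau_other, hy]
        · exact h0.symm
        · intro i
          refine Fin.lastCases ?_ (fun i => ?_) i
          · intro h
            exact hc1 (uniq _ (by rw [h]; exact hkey)).symm
          · intro h
            exact hc2 i (uniq _ (by rw [h]; exact pos_self (key F) (wt F) (AZ a) T i))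

lemma prod_rotate
    (hinj : ∀ j, Function.Injective (a j)) (H : Rel (key F) (wt F) (AZ a))
    : prodT a n = finRotate (k*n+1) := by
  apply Equiv.ext
  intro x
  apply Fin.ext
  by_cases hx : x = Fin.last _
  · subst hx
    rw [finRotate_last]
    have := traj hinj H n le_rfl none (Fin.last _) (by simp [start])
    rw [pos_none_top] at this
    simpa using this
  · have hlt : (x : ℕ) < k * n := by
      have h1 := x.2
      have h2 : (x : ℕ) ≠ k * n := fun h => hx (Fin.ext h)
      omega
    obtain ⟨p, hp⟩ := cover_all H ((x : ℕ) : ℤ) (by positivity) (by exact_mod_cast hlt)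
    have := traj hinj H n le_rfl (some p) x hp.symm
    rw [pos_some_top H p.1 p.2] at this
    rw [coe_finRotate_of_ne_last hx]
    have h2 : start (key F) (wt F) (AZ a) (some (p.1, p.2)) = ((x : ℕ) : ℤ) := hp
    rw [h2] at this
    exact_mod_cast this

lemma key_unique
    (hinj : ∀ j, Function.Injective (a j)) (H : Rel (key F) (wt F) (AZ a))
    {G : KForest n k} (HG : Rel (key G) (wt G) (AZ a)) : F = G := by
  have hX : ∀ c, start (key F) (wt F) (AZ a) c = start (key G) (wt G) (AZ a) c := by
    intro c
    rcases c with _ | ⟨j, i⟩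
    · rfl
    · obtain ⟨x, hx⟩ := start_fin H (some (j, i))
      obtain ⟨y, hy⟩ := start_fin HG (some (j, i))
      have h1 := traj hinj H j.val j.2.le _ x hx
      have h2 := traj hinj HG j.val j.2.le _ y hy
      rw [pos_self] at h1 h2
      have h3 : prodT a j.val x = prodT a j.val y := by
        apply Fin.ext
        exact_mod_cast h1.trans h2.symm
      have h4 := (prodT a j.val).injective h3
      rw [← hx, ← hy, h4]
  apply key_inj
  funext v
  obtain ⟨x, hx⟩ := start_fin H (key F v)
  obtain ⟨y, hy⟩ := start_fin HG (key G v)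
  have h1 := traj hinj H v.val v.2.le _ x hx
  have h2 := traj hinj HG v.val v.2.le _ y hy
  rw [H.hp] at h1
  rw [HG.hp] at h2
  have h3 : prodT a v.val x = prodT a v.val y := by
    apply Fin.ext
    exact_mod_cast h1.trans h2.symm
  have h4 := (prodT a v.val).injective h3
  apply start_inj H
  rw [← hx, hX, ← hy, h4]

end Traj

section Unique

lemma row_unique {F : KForest n k} {A B : Fin n → Fin (k+1) → ℤ}
    (HA : Rel (key F) (wt F) A) (HB : Rel (key F) (wt F) B) : A = B := by
  have main : ∀ (m : ℕ) (v : Fin n), n - F.toRootedForest.h v = m → A v = B v := by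
    intro m
    induction m using Nat.strong_induction_on with
    | _ m ih =>
      intro v hv
      have hpos : pos (key F) (wt F) A (key F v) v.val = pos (key F) (wt F) B (key F v) v.val := by
        rcases hc : key F v with _ | ⟨j, i⟩
        · rfl
        · have h1 := h_lt F.toRootedForest (key_some hc)
          have h2 := h_le F.toRootedForest j
          have h3 := ih _ (by omega) j rfl
          simp [pos, start, jump, h3]
      rw [HA.hp, HB.hp] at hpos
      have h0 : A v 0 = B v 0 := by
        have h1 := HA.hw v
        have h2 := HB.hw v
        linarith
      funext i
      induction i using Fin.induction with
      | zero => exact h0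
      | succ i ih =>
        have h1 := HA.hs v i
        have h2 := HB.hs v i
        linarith
  funext v
  exact main _ v rfl

end Unique

end KFact
namespace KFact

open Finset

variable {n k : ℕ}

def idx (F : KForest n k) (v : Fin n) : Fin k :=
  ⟨k - 1 - F.colour v, by have := F.colour_lt v; omega⟩

lemma key_iff (F : KForest n k) (v j : Fin n) (i : Fin k) :
    key F v = some (j, i) ↔ F.parent v = some j ∧ idx F v = i := by
  rcases h : F.parent v with _ | u
  · simp [key, h]
  · simp [key, h, idx]

lemma sum_key (F : KForest n k) (j : Fin n) (Q : Fin n → Prop) [DecidablePred Q]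
    (g : Fin n → Fin k → ℤ) :
    ∑ i, ∑ v ∈ univ.filter (fun v => key F v = some (j, i) ∧ Q v), g v i =
      ∑ v ∈ univ.filter (fun v => F.parent v = some j ∧ Q v), g v (idx F v) := by
  simp only [Finset.sum_filter]
  rw [Finset.sum_comm]
  apply Finset.sum_congr rfl
  intro v _
  simp only [key_iff]
  by_cases h : F.parent v = some j ∧ Q v
  · simp [h.1, h.2]
  · rw [if_neg h]
    apply Finset.sum_eq_zero
    intro i _
    rw [if_neg]
    tauto

lemma sum_key' (F : KForest n k) (j : Fin n) (g : Fin n → Fin k → ℤ) :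
    ∑ i, ∑ v ∈ univ.filter (fun v => key F v = some (j, i)), g v i =
      ∑ v ∈ univ.filter (fun v => F.parent v = some j), g v (idx F v) := by
  simpa using sum_key F j (fun _ => True) g

lemma telescope (g : Fin (k+1) → ℤ) :
    ∑ i : Fin k, (g i.succ - g i.castSucc) = g (Fin.last k) - g 0 := by
  have h1 := Fin.sum_univ_succ g
  have h2 := Fin.sum_univ_castSucc g
  rw [Finset.sum_sub_distrib]
  linarith

lemma abel_cast : ∀ {k : ℕ} (g : Fin (k+1) → ℤ), ∑ i : Fin k, g i.castSucc =
    k * g 0 + ∑ i : Fin k, ((k : ℤ) - 1 - (i : ℕ)) * (g i.succ - g i.castSucc) := by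
  intro k
  induction k with
  | zero => intro g; simp
  | succ k ih =>
    intro g
    have h := ih (fun i => g i.castSucc)
    have ht := telescope (fun i : Fin (k+1) => g i.castSucc)
    rw [Fin.sum_univ_castSucc, h, Fin.sum_univ_castSucc]
    simp only [Fin.castSucc_zero, Fin.succ_castSucc, Fin.val_castSucc, Fin.val_last] at ht ⊢
    have h3 : ∑ i : Fin k, ((((k + 1 : ℕ) : ℤ)) - 1 - (i : ℕ)) *
        (g i.succ.castSucc - g i.castSucc.castSucc) =
        ∑ i : Fin k, ((k : ℤ) - 1 - (i : ℕ)) *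
        (g i.succ.castSucc - g i.castSucc.castSucc) +
        ∑ i : Fin k, (g i.succ.castSucc - g i.castSucc.castSucc) := by
      rw [← Finset.sum_add_distrib]
      apply Finset.sum_congr rfl
      intro i _
      push_cast
      ring
    rw [h3, ht]
    push_cast
    ring

lemma abel_succ (g : Fin (k+1) → ℤ) : ∑ i : Fin k, g i.succ =
    k * g (Fin.last k) - ∑ i : Fin k, ((i : ℕ) : ℤ) * (g i.succ - g i.castSucc) := by
  have h1 := abel_cast g
  have h2 := telescope g
  have h3 : ∑ i : Fin k, ((k : ℤ) - 1 - (i : ℕ)) * (g i.succ - g i.castSucc) =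
      ((k : ℤ) - 1) * ∑ i : Fin k, (g i.succ - g i.castSucc) -
      ∑ i : Fin k, ((i : ℕ) : ℤ) * (g i.succ - g i.castSucc) := by
    rw [Finset.mul_sum, ← Finset.sum_sub_distrib]
    apply Finset.sum_congr rfl
    intro i _
    ring
  rw [h3] at h1
  rw [h2] at h1
  rw [Finset.sum_sub_distrib] at h2
  linarith

lemma gauss (k : ℕ) : ∑ i : Fin k, ((i : ℕ) : ℤ) = (k.choose 2 : ℤ) := by
  rw [Fin.sum_univ_eq_sum_range (fun i => (i : ℤ)), ← Nat.cast_sum, Finset.sum_range_id,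
    Nat.choose_two_right]

lemma gauss_rev (k : ℕ) : ∑ i : Fin k, ((k : ℤ) - 1 - (i : ℕ)) = (k.choose 2 : ℤ) := by
  rw [Finset.sum_sub_distrib, gauss]
  have h : (k.choose 2) * 2 = k * (k - 1) := by
    rw [Nat.choose_two_right]
    exact Nat.div_mul_cancel (Nat.even_mul_pred_self k).two_dvd
  have h2 : ((k.choose 2 : ℕ) : ℤ) * 2 = k * ((k : ℤ) - 1) := by
    rcases k with _ | k
    · simp
    · have : ((((k+1).choose 2 * 2 : ℕ)) : ℤ) = ((k + 1) * (k + 1 - 1) : ℕ) := by rw [h]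
      push_cast at this ⊢
      simpa using this
  simp
  linarith

/-! ### Existence of the factorization of a forest -/

lemma exists_fix {V β : Type} (d : β) (p : V → Option V) (m : V → ℕ)
    (hm : ∀ v u, p v = some u → m u < m v) (g : V → Option β → β) :
    ∃ A : V → β, ∀ v, A v = g v ((p v).map A) := by
  let B : ℕ → V → β := fun s => Nat.rec (fun _ => d) (fun _ b v => g v ((p v).map b)) s
  have hB : ∀ s v, B (s + 1) v = g v ((p v).map (B s)) := fun s v => rfl
  have claim : ∀ s t v, m v < s → m v < t → B s v = B t v := by
    intro s
    induction s with
    | zero => intro t v h; omega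
    | succ s ih =>
      intro t v h1 h2
      rcases t with _ | t
      · omega
      · rw [hB, hB]
        rcases h : p v with _ | u
        · rfl
        · have := hm v u h
          simp only [Option.map_some]
          rw [ih t u (by omega) (by omega)]
  refine ⟨fun v => B (m v + 1) v, fun v => ?_⟩
  change B (m v + 1) v = _
  rw [hB]
  rcases h : p v with _ | u
  · rfl
  · have := hm v u h
    simp only [Option.map_some]
    rw [claim (m v) (m u + 1) u (by omega) (by omega)]

lemma wt_rec (F : KForest n k) (j : Fin n) :
    wt F j = ∑ i : Fin k, (1 + low (key F) (wt F) (some (j, i)) n) := by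
  rw [Finset.sum_add_distrib]
  simp only [low_top]
  rw [sum_key' F j (fun v _ => wt F v), wt, h_rec]
  simp only [wt, ← Finset.mul_sum]
  push_cast
  simp
  ring

lemma exists_rel (F : KForest n k) : ∃ A, Rel (key F) (wt F) A := by
  let off : Fin n → Fin (k+1) → ℤ := fun v i =>
    ∑ i' ∈ univ.filter (fun i' : Fin k => i'.val < i.val),
      (1 + low (key F) (wt F) (some (v, i')) n)
  obtain ⟨A, hA⟩ := exists_fix (β := Fin (k+1) → ℤ) (fun _ => 0) F.parent
    (fun v => n - F.toRootedForest.h v)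
    (by
      intro v u h
      have h1 := h_lt F.toRootedForest h
      have h2 := h_le F.toRootedForest u
      omega)
    (fun v o i => pos (key F) (wt F) (fun _ => o.getD (fun _ => 0)) (key F v) v.val
      - wt F v + off v i)
  have hoff0 : ∀ v, off v 0 = 0 := by intro v; simp [off]
  have hoffl : ∀ v, off v (Fin.last k) = wt F v := by
    intro v
    rw [wt_rec]
    simp [off]
  have hoffs : ∀ v (i : Fin k), off v i.succ - off v i.castSucc =
      1 + low (key F) (wt F) (some (v, i)) n := by
    intro v i
    have : univ.filter (fun i' : Fin k => i'.val < i.succ.val) =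
        insert i (univ.filter (fun i' : Fin k => i'.val < i.castSucc.val)) := by
      ext i'
      simp only [mem_filter, mem_univ, true_and, mem_insert, Fin.val_succ, Fin.val_castSucc,
        Fin.ext_iff]
      omega
    simp only [off]
    rw [this, Finset.sum_insert (by simp)]
    ring
  have hb : ∀ v i, A v i = pos (key F) (wt F) A (key F v) v.val - wt F v + off v i := by
    intro v i
    rw [hA v]
    rcases h : F.parent v with _ | u
    · rw [key_none.mpr h]
      rfl
    · have hk : key F v = some (u, idx F v) := (key_iff F v u _).mpr ⟨h, rfl⟩
      rw [hk]
      simp [pos, start, jump]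
  refine ⟨A, ⟨?_, ?_, ?_⟩⟩
  · intro v
    rw [hb, hb, hoff0, hoffl]
    ring
  · intro j i
    rw [hb, hb j i.castSucc, ← hoffs]
    ring
  · intro v
    rw [hb, hoffl]
    ring

section Range

variable {F : KForest n k} {A : Fin n → Fin (k+1) → ℤ}


lemma rows_mono
    (H : Rel (key F) (wt F) A)
    (j : Fin n) : StrictMono (A j) := by
  rw [Fin.strictMono_iff_lt_succ]
  intro i
  have := step_pos H j i
  linarith

lemma nest
    (H : Rel (key F) (wt F) A)
    {v j : Fin n} {i : Fin k} (h : key F v = some (j, i)) :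
    A j i.castSucc ≤ A v 0 ∧ A v (Fin.last k) ≤ A j i.succ := by
  have h1 := H.hp v
  have h2 := pos_key H v
  have h3 := pos_self (key F) (wt F) A j i
  have h4 := pos_self_succ (key F) (wt F) A j i key_ne
  have h5 := pos_some_top H j i
  have h6 := pos_zero (key F) (wt F) A (some (j, i))
  have hne : v ≠ j := by
    rintro rfl
    exact key_ne h
  have hj := j.2
  have hv := v.2
  rw [h] at h1 h2
  have anti := fun (s t : ℕ) (hst : s ≤ t) (h' : jump A (some (j, i)) s = jump A (some (j, i)) t) =>
    pos_anti (key F) (wt F) A (wt_nonneg F) (some (j, i)) hst h'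
  have a1 := anti 0 j.val (by omega) (by simp [jump])
  have a2 := anti (j.val + 1) n (by omega) (by simp [jump])
  rcases lt_or_gt_of_ne (fun h => hne (Fin.ext h) : v.val ≠ j.val) with hlt | hlt
  · have a3 := anti 0 v.val (by omega) (by simp [jump]; omega)
    have a4 := anti (v.val + 1) j.val (by omega) (by simp [jump]; omega)
    constructor <;> linarith
  · have a3 := anti (j.val + 1) v.val (by omega) (by simp [jump]; omega)
    have a4 := anti (v.val + 1) n (by omega) (by simp [jump]; omega)
    constructor <;> linarith

lemma range_all
    (H : Rel (key F) (wt F) A)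
    (m : ℕ) : ∀ v : Fin n, n - F.toRootedForest.h v = m →
    0 ≤ A v 0 ∧ A v (Fin.last k) ≤ (k : ℤ) * n := by
  induction m using Nat.strong_induction_on with
  | _ m ih =>
    intro v hv
    rcases hc : key F v with _ | ⟨j, i⟩
    · have h1 := H.hp v
      have h2 := pos_key H v
      rw [hc] at h1 h2
      have h3 := pos_none_top F A
      have h4 := pos_zero (key F) (wt F) A none
      have hv := v.2
      have a1 := pos_anti (key F) (wt F) A (wt_nonneg F) none (Nat.zero_le v.val) rfl
      have a2 := pos_anti (key F) (wt F) A (wt_nonneg F) none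
        (show v.val + 1 ≤ n by omega) rfl
      have h5 : start (key F) (wt F) A none = (k : ℤ) * n := rfl
      constructor <;> linarith
    · have h1 := h_lt F.toRootedForest (key_some hc)
      have h2 := h_le F.toRootedForest j
      obtain ⟨h3, h4⟩ := ih _ (by omega) j rfl
      obtain ⟨h5, h6⟩ := nest H hc
      have h7 := (rows_mono H j).monotone (Fin.zero_le i.castSucc)
      have h8 := (rows_mono H j).monotone (Fin.le_last i.succ)
      constructor <;> linarith

end Range

lemma exists_fact (F : KForest n k) : ∃ f : MinKFact n k, Rel (key F) (wt F) (AZ f.a) := by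
  obtain ⟨A, H⟩ := exists_rel F
  have hr : ∀ v i, 0 ≤ A v i ∧ A v i ≤ (k : ℤ) * n := by
    intro v i
    obtain ⟨h1, h2⟩ := range_all H _ v rfl
    have h7 := (rows_mono H v).monotone (Fin.zero_le i)
    have h8 := (rows_mono H v).monotone (Fin.le_last i)
    constructor <;> linarith
  have hlt : ∀ v i, (A v i).toNat < k * n + 1 := by
    intro v i
    have := hr v i
    zify
    rw [Int.toNat_of_nonneg this.1]
    linarith
  let a : Fin n → Fin (k+1) → Fin (k*n+1) := fun v i => ⟨(A v i).toNat, hlt v i⟩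
  have haz : AZ a = A := by
    funext v i
    simp [AZ, a, (hr v i).1]
  rw [← haz] at H
  have hmono : ∀ j, StrictMono (a j) := by
    intro j x y hxy
    have := rows_mono H j hxy
    simp only [AZ] at this
    exact_mod_cast this
  have hinj : ∀ j, Function.Injective (a j) := fun j => (hmono j).injective
  refine ⟨⟨a, hinj, fun j i => (hmono j).monotone (Fin.zero_le i), ?_⟩, H⟩
  rw [← prodT_top]
  exact prod_rotate hinj H

end KFact
namespace KFact

open Finset

variable {n k : ℕ}

/-! ### From factorizations to forests -/

section Fact

variable {a : Fin n → Fin (k+1) → Fin (k*n+1)}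

lemma exists_ascent (hinj : ∀ j, Function.Injective (a j))
    (hmin : ∀ j i, a j 0 ≤ a j i) (hprod : prodT a n = finRotate (k*n+1))
    (x : Fin (k*n+1)) (hx : x ≠ Fin.last _) :
    ∃ (j : Fin n) (i : Fin k), prodT a j.val x = a j i.castSucc ∧ a j i.castSucc < a j i.succ := by
  by_contra hcon
  push Not at hcon
  have main : ∀ t, t ≤ n → prodT a t x ≤ x := by
    intro t
    induction t with
    | zero => intro _; simp [prodT_zero]
    | succ t ih =>
      intro ht
      have ih' := ih (by omega)
      obtain ⟨T, rfl⟩ : ∃ T : Fin n, T.val = t := ⟨⟨t, by omega⟩, rfl⟩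
      rw [prodT_succ a T, Equiv.Perm.mul_apply]
      refine le_trans ?_ ih'
      by_cases h : ∃ i, prodT a T.val x = a T i
      · obtain ⟨i, hi⟩ := h
        revert hi
        refine Fin.lastCases ?_ (fun i => ?_) i
        · intro hi
          rw [hi, tau_last]
          exact hmin _ _
        · intro hi
          have := hcon T i hi
          rw [hi, tau_step a T (hinj T)]
          exact this
      · push Not at h
        rw [tau_other a T _ h]
  have h1 := main n le_rfl
  rw [hprod, Fin.le_def, coe_finRotate_of_ne_last hx] at h1
  omega

/-- starting points of trajectories -/
def startX (a : Fin n → Fin (k+1) → Fin (k*n+1)) (c : Option (Fin n × Fin k)) : Fin (k*n+1) :=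
  match c with
  | none => Fin.last _
  | some (j, i) => (prodT a j.val).symm (a j i.castSucc)

lemma startX_bij (hinj : ∀ j, Function.Injective (a j))
    (hmin : ∀ j i, a j 0 ≤ a j i) (hprod : prodT a n = finRotate (k*n+1)) :
    Function.Bijective (startX a) := by
  rw [Fintype.bijective_iff_surjective_and_card]
  constructor
  · intro x
    by_cases hx : x = Fin.last _
    · exact ⟨none, hx.symm⟩
    · obtain ⟨j, i, h, _⟩ := exists_ascent hinj hmin hprod x hx
      refine ⟨some (j, i), ?_⟩
      simp only [startX]
      rw [← h]
      simp
  · simp [mul_comm]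

lemma startX_none : startX a none = Fin.last _ := rfl

lemma prodT_startX (j : Fin n) (i : Fin k) :
    prodT a j.val (startX a (some (j, i))) = a j i.castSucc := by
  simp [startX]

lemma ascents (hinj : ∀ j, Function.Injective (a j))
    (hmin : ∀ j i, a j 0 ≤ a j i) (hprod : prodT a n = finRotate (k*n+1)) (j : Fin n) (i : Fin k) :
    a j i.castSucc < a j i.succ := by
  have hb := startX_bij hinj hmin hprod
  have hne : startX a (some (j, i)) ≠ Fin.last _ := by
    intro h
    rw [← startX_none] at h
    exact absurd (hb.1 h) (by simp)
  obtain ⟨j', i', h, h'⟩ := exists_ascent hinj hmin hprod _ hne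
  have h2 : startX a (some (j', i')) = startX a (some (j, i)) := by
    apply (prodT a j'.val).injective
    rw [prodT_startX, h]
  have h3 := Option.some.inj (hb.1 h2)
  obtain ⟨rfl, rfl⟩ := Prod.mk.inj h3
  exact h'

lemma exists_K (hinj : ∀ j, Function.Injective (a j))
    (hmin : ∀ j i, a j 0 ≤ a j i) (hprod : prodT a n = finRotate (k*n+1)) :
    ∃ K : Fin n → Option (Fin n × Fin k),
      Rel K (fun v => AZ a v (Fin.last k) - AZ a v 0) (AZ a) := by
  have hb := startX_bij hinj hmin hprod
  have hK : ∀ v : Fin n, ∃ c, startX a c = (prodT a v.val).symm (a v (Fin.last k)) :=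
    fun v => hb.2 _
  choose K hK using hK
  have hK' : ∀ v : Fin n, prodT a v.val (startX a (K v)) = a v (Fin.last k) := by
    intro v
    rw [hK]
    simp
  have hne : ∀ v i, K v ≠ some (v, i) := by
    intro v i h
    have h1 := hK' v
    rw [h, prodT_startX] at h1
    have := hinj v h1
    exact absurd this (Fin.castSucc_lt_last i).ne
  set w : Fin n → ℤ := fun v => AZ a v (Fin.last k) - AZ a v 0 with hw
  have main : ∀ t, t ≤ n → ∀ c, ((prodT a t (startX a c) : ℕ) : ℤ) =
      ((startX a c : ℕ) : ℤ) - low K w c t + jump (AZ a) c t := by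
    intro t
    induction t with
    | zero =>
      intro _ c
      rw [low_zero, prodT_zero]
      rcases c with _ | ⟨j, i⟩ <;> simp [jump]
    | succ t ih =>
      intro ht c
      have ih' := ih (by omega) c
      obtain ⟨T, rfl⟩ : ∃ T : Fin n, T.val = t := ⟨⟨t, by omega⟩, rfl⟩
      rw [prodT_succ a T, Equiv.Perm.mul_apply, low_succ]
      by_cases h1 : K T = c
      · subst h1
        rw [hK', tau_last, jump_succ_ne _ _ _ (hne T)]
        rw [hK'] at ih'
        simp only [if_true, hw, AZ]
        simp only [hw, AZ] at ih'
        linarith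
      · rw [if_neg h1]
        by_cases h2 : ∃ i, c = some (T, i)
        · obtain ⟨i, rfl⟩ := h2
          rw [prodT_startX, tau_step a T (hinj T)]
          rw [prodT_startX] at ih'
          simp only [jump, lt_irrefl, if_false, lt_add_one, if_true, AZ] at ih' ⊢
          linarith
        · push Not at h2
          rw [jump_succ_ne _ _ _ h2, tau_other, ih']
          · ring
          · intro i
            refine Fin.lastCases ?_ (fun i => ?_) i
            · intro h
              rw [← hK'] at h
              exact h1 (hb.1 ((prodT a T.val).injective h)).symm
            · intro h
              rw [← prodT_startX (a := a)] at h
              exact h2 i (hb.1 ((prodT a T.val).injective h))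
  have hstart : ∀ c, ((startX a c : ℕ) : ℤ) = start K w (AZ a) c := by
    intro c
    rcases c with _ | ⟨j, i⟩
    · simp [startX, start]
    · have h := main j.val j.2.le (some (j, i))
      rw [prodT_startX] at h
      simp only [jump, lt_irrefl, if_false] at h
      simp only [start, AZ]
      linarith
  refine ⟨K, ⟨fun v => rfl, ?_, ?_⟩⟩
  · intro j i
    have h := main n le_rfl (some (j, i))
    have hne : startX a (some (j, i)) ≠ Fin.last _ := by
      intro h
      rw [← startX_none] at h
      exact absurd (hb.1 h) (by simp)
    rw [hprod, coe_finRotate_of_ne_last hne] at h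
    simp only [jump, j.2, if_true] at h
    push_cast at h
    linarith
  · intro v
    have h := main v.val v.2.le (K v)
    rw [hK', hstart] at h
    exact h.symm

end Fact

lemma exists_KF (hk : 1 ≤ k) (f : MinKFact n k) :
    ∃ F : KForest n k, Rel (key F) (wt F) (AZ f.a) := by
  have hprod : prodT f.a n = finRotate (k*n+1) := by
    rw [prodT_top]; exact f.prod_eq
  obtain ⟨K, HK⟩ := exists_K f.inj f.min_first hprod
  have hasc := ascents f.inj f.min_first hprod
  have hmono : ∀ j, StrictMono (f.a j) := by
    intro j
    rw [Fin.strictMono_iff_lt_succ]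
    exact hasc j
  have hmonoZ : ∀ j, Monotone (AZ f.a j) := by
    intro j x y h
    simp only [AZ]
    exact_mod_cast (hmono j).monotone h
  set w : Fin n → ℤ := fun v => AZ f.a v (Fin.last k) - AZ f.a v 0 with hw
  have hwn : ∀ v, 0 ≤ w v := by
    intro v
    have := hmonoZ v (Fin.zero_le (Fin.last k))
    simp only [hw]
    linarith
  have hlt : ∀ v j i, K v = some (j, i) → w v < w j := by
    intro v j i h
    have h1 := hmonoZ j (Fin.zero_le i.castSucc)
    have h2 := hmonoZ j (Fin.le_last i.succ)
    have h3 := HK.hs j i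
    have h4 : w v ≤ low K w (some (j, i)) n := by
      rw [low_top]
      exact Finset.single_le_sum (f := w) (fun v _ => hwn v) (by simp [h])
    have h5 : w j = AZ f.a j (Fin.last k) - AZ f.a j 0 := rfl
    linarith
  obtain ⟨F, rfl⟩ := exists_forest hk K w hlt
  have hrec : ∀ j, w j = k + ∑ v ∈ univ.filter (fun v => F.parent v = some j), w v := by
    intro j
    have h1 := telescope (AZ f.a j)
    simp only [HK.hs, low_top] at h1
    rw [Finset.sum_add_distrib, sum_key' F j (fun v _ => w v)] at h1
    simp at h1
    have h5 : w j = AZ f.a j (Fin.last k) - AZ f.a j 0 := rfl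
    linarith
  have hwt : ∀ (m : ℕ) (v : Fin n), F.toRootedForest.h v = m → w v = wt F v := by
    intro m
    induction m using Nat.strong_induction_on with
    | _ m ih =>
      intro v hv
      rw [hrec, wt, h_rec]
      push_cast
      rw [mul_add, Finset.mul_sum]
      congr 1
      · simp
      · apply Finset.sum_congr rfl
        intro u hu
        simp only [mem_filter, mem_univ, true_and] at hu
        have := h_lt F.toRootedForest hu
        exact ih _ (by omega) u rfl
  have : w = wt F := funext fun v => hwt _ v rfl
  rw [this] at HK
  exact ⟨F, HK⟩

/-! ### Statistics -/

section Stats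

variable {F : KForest n k} {A : Fin n → Fin (k+1) → ℤ}

lemma low_hL (F : KForest n k) (j : Fin n) :
    ∑ i : Fin k, low (key F) (wt F) (some (j, i)) j.val = k * (F.toRootedForest.hL j : ℤ) := by
  simp only [low]
  rw [sum_key F j (fun v => v.val < j.val) (fun v _ => wt F v), RootedForest.hL]
  push_cast
  rw [Finset.mul_sum]
  rfl

lemma low_hLR (F : KForest n k) (j : Fin n) :
    ∑ i : Fin k, low (key F) (wt F) (some (j, i)) n =
      k * (F.toRootedForest.hL j : ℤ) + k * (F.toRootedForest.hR j : ℤ) := by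
  simp only [low_top]
  rw [sum_key' F j (fun v _ => wt F v), RootedForest.hL, RootedForest.hR]
  push_cast
  rw [Finset.mul_sum, Finset.mul_sum, ← Finset.sum_union]
  · apply Finset.sum_congr
    · ext v
      simp only [mem_filter, mem_univ, true_and, mem_union]
      constructor
      · intro h
        have hne : v ≠ j := by
          rintro rfl
          exact F.acyclic _ (Relation.TransGen.single h)
        rcases lt_or_gt_of_ne hne with h' | h'
        · exact Or.inl ⟨h, h'⟩
        · exact Or.inr ⟨h, h'⟩
      · rintro (h | h) <;> exact h.1
    · intro v _
      rfl
  · rw [Finset.disjoint_left]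
    intro v h1 h2
    simp only [mem_filter, mem_univ, true_and] at h1 h2
    exact lt_asymm h1.2 h2.2

lemma sum_parents (F : KForest n k) (g : Fin n → ℤ) :
    ∑ j, ∑ v ∈ univ.filter (fun v => F.parent v = some j), g v =
      ∑ v ∈ univ.filter (fun v => F.parent v ≠ none), g v := by
  simp only [Finset.sum_filter]
  rw [Finset.sum_comm]
  apply Finset.sum_congr rfl
  intro v _
  rcases h : F.parent v with _ | u <;> simp


lemma stat_semi
    (H : Rel (key F) (wt F) A)
    : ((k*n).choose 2 : ℤ) - ∑ i : Fin k, ∑ j : Fin n, A j i.castSucc =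
    k * (F.toRootedForest.maj : ℤ) := by
  have h := sum_start H
  rw [Fintype.sum_prod_type] at h
  simp only [start, Finset.sum_add_distrib, low_hL] at h
  rw [Finset.sum_comm, ← h, RootedForest.maj]
  push_cast
  rw [Finset.mul_sum]
  ring

lemma stat_cosemi
    (H : Rel (key F) (wt F) A)
    : (∑ i : Fin k, ∑ j : Fin n, (A j i.succ - 1)) - ((k*n).choose 2 : ℤ) =
    k * (F.toRootedForest.comaj : ℤ) := by
  have h := sum_start H
  rw [Fintype.sum_prod_type] at h
  simp only [start, Finset.sum_add_distrib, low_hL] at h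
  have h2 : ∀ j, ∑ i : Fin k, (A j i.succ - 1) = ∑ i : Fin k, A j i.castSucc +
      (k * (F.toRootedForest.hL j : ℤ) + k * (F.toRootedForest.hR j : ℤ)) := by
    intro j
    rw [← low_hLR, ← Finset.sum_add_distrib]
    apply Finset.sum_congr rfl
    intro i _
    have := H.hs j i
    linarith
  rw [Finset.sum_comm, RootedForest.comaj]
  simp only [h2]
  push_cast
  rw [Finset.mul_sum, ← h]
  simp only [Finset.sum_add_distrib]
  ring

lemma stat_cast
    (H : Rel (key F) (wt F) A)
    : ∑ i : Fin k, ∑ j : Fin n, A j i.castSucc =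
    k * ∑ j : Fin n, A j 0 + n * (k.choose 2 : ℤ) + k * (F.chr : ℤ) := by
  have h1 : ∀ j, ∑ i : Fin k, A j i.castSucc = k * A j 0 + (k.choose 2 : ℤ) +
      ∑ v ∈ univ.filter (fun v => F.parent v = some j), (F.colour v : ℤ) * wt F v := by
    intro j
    rw [abel_cast]
    simp only [H.hs, mul_add, mul_one, Finset.sum_add_distrib, gauss_rev, low_top, Finset.mul_sum]
    rw [sum_key' F j (fun v i => ((k : ℤ) - 1 - (i : ℕ)) * wt F v), add_assoc]
    congr 2
    apply Finset.sum_congr rfl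
    intro v _
    congr 1
    have := F.colour_lt v
    simp only [idx]
    omega
  rw [Finset.sum_comm]
  simp only [h1, Finset.sum_add_distrib]
  rw [sum_parents, ← Finset.mul_sum, KForest.chr]
  push_cast
  congr 1
  · simp
  · rw [Finset.mul_sum]
    apply Finset.sum_congr rfl
    intro v _
    rw [wt]
    ring

lemma stat_succ
    (H : Rel (key F) (wt F) A)
    : ∑ i : Fin k, ∑ j : Fin n, (A j i.succ - 1) =
    k * ∑ j : Fin n, (A j (Fin.last k) - 1) - n * (k.choose 2 : ℤ) - k * (F.cochr : ℤ) := by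
  have h1 : ∀ j, ∑ i : Fin k, (A j i.succ - 1) = k * (A j (Fin.last k) - 1) - (k.choose 2 : ℤ) -
      ∑ v ∈ univ.filter (fun v => F.parent v = some j), ((k - 1 - F.colour v : ℕ) : ℤ) * wt F v := by
    intro j
    rw [Finset.sum_sub_distrib, abel_succ]
    simp only [H.hs, mul_add, mul_one, Finset.sum_add_distrib, gauss, low_top, Finset.mul_sum]
    rw [sum_key' F j (fun v i => ((i : ℕ) : ℤ) * wt F v)]
    simp only [idx, sum_const, card_univ, Fintype.card_fin, nsmul_eq_mul, mul_one]
    ring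
  rw [Finset.sum_comm]
  simp only [h1]
  rw [Finset.sum_sub_distrib, Finset.sum_sub_distrib, sum_parents, ← Finset.mul_sum, KForest.cochr]
  rw [Nat.cast_sum, Finset.mul_sum (univ.filter (fun v => F.parent v ≠ none))]
  congr 1
  · simp
  · apply Finset.sum_congr rfl
    intro v _
    rw [wt, Nat.cast_mul]
    ring

end Stats

lemma AZ_inj {f g : MinKFact n k} (h : AZ f.a = AZ g.a) : f = g := by
  have : f.a = g.a := by
    funext j i
    apply Fin.ext
    have := congrFun (congrFun h j) i
    simp only [AZ] at this
    exact_mod_cast this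
  obtain ⟨a, _, _, _⟩ := f
  obtain ⟨b, _, _, _⟩ := g
  simp only at this
  subst this
  rfl

end KFact

/-- For all `n, k ≥ 1` there is a bijection `φ : F_n^k → R_n^k` such that,
with `F = φ f`: `area_k f = k·maj_k F`, `coarea_k f = k·comaj_k F`,
`semiarea_k f = k·maj F`, `cosemiarea_k f = k·comaj F`, and `a_j^k - a_j^0 = k·h(j)`
for every vertex `j`. -/
theorem stmt1 (n k : ℕ) (hn : 1 ≤ n) (hk : 1 ≤ k) :
    ∃ φ : MinKFact n k ≃ KForest n k,
      ∀ f : MinKFact n k,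
        MinKFact.areak f = k * (KForest.majk (φ f) : ℤ) ∧
        MinKFact.coareak f = k * (KForest.comajk (φ f) : ℤ) ∧
        MinKFact.semiareak f = k * ((φ f).toRootedForest.maj : ℤ) ∧
        MinKFact.cosemiareak f = k * ((φ f).toRootedForest.comaj : ℤ) ∧
        ∀ j : Fin n,
          ((f.a j (Fin.last k) : ℕ) : ℤ) - ((f.a j 0 : ℕ) : ℤ)
            = k * ((φ f).toRootedForest.h j : ℤ) := by
  choose Φ hΦ using fun f : MinKFact n k => KFact.exists_KF hk f
  have hbij : Function.Bijective Φ := by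
    constructor
    · intro f g h
      have h1 := hΦ f
      have h2 := hΦ g
      rw [← h] at h2
      exact KFact.AZ_inj (KFact.row_unique h1 h2)
    · intro F
      obtain ⟨f, hf⟩ := KFact.exists_fact F
      exact ⟨f, KFact.key_unique f.inj (hΦ f) hf⟩
  refine ⟨Equiv.ofBijective Φ hbij, fun f => ?_⟩
  have H := hΦ f
  have hsemi := KFact.stat_semi H
  have hcosemi := KFact.stat_cosemi H
  have hcast := KFact.stat_cast H
  have hsucc := KFact.stat_succ H
  rw [Equiv.ofBijective_apply]
  simp only [KFact.AZ] at hsemi hcosemi hcast hsucc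
  refine ⟨?_, ?_, hsemi, hcosemi, ?_⟩
  · rw [MinKFact.areak, KForest.majk]
    push_cast
    linarith
  · rw [MinKFact.coareak, KForest.comajk]
    push_cast
    linarith
  · intro j
    exact H.hw j
end
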